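/- arXiv:2210.04340 — 5 statements merged into one kernel-verified Lean document; each statement's English description precedes it below -/
import Mathlib

section
/- Let n ≥ 2, let Ω ⊆ ℝⁿ be open with 0 < |Ω| < ∞, let 1 < α ≤ n/(n−1), let p > 1 with p − α(p−1) > 0, and let SN > 0. Set q = p/(p − α(p−1)). Assume that for every C¹ function g : Ω → ℝ with g ∈ L^α(Ω) and |∇g| ∈ L¹(Ω) one has inf_{k∈ℝ} ‖g − k‖_{L^α(Ω)} ≤ SN^{-1} ∫_Ω |∇g| dx. Then for every C¹ function f : Ω → ℝ with f ∈ L^{αq}(Ω) and |∇f| ∈ L^p(Ω), and every k ∈ ℝ satisfying ∫_Ω sgn(f − k)·|f − k|^{q(α−1)} dx = 0, one has ‖f − k‖_{L^{αq}(Ω)} ≤ q · SN^{-1} · ‖∇f‖_{L^p(Ω)}. -/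
open MeasureTheory

lemma hasDerivAt_mul_abs_rpow {r : ℝ} (hr : 0 < r) (t : ℝ) :
    HasDerivAt (fun s : ℝ => s * |s| ^ r) ((r + 1) * |t| ^ r) t := by
  rcases eq_or_ne t 0 with rfl | ht
  · rw [hasDerivAt_iff_tendsto_slope_zero]
    have hc : Continuous fun s : ℝ => |s| ^ r := continuous_abs.rpow_const fun _ => Or.inr hr.le
    have hlim : Filter.Tendsto (fun s : ℝ => |s| ^ r) (nhdsWithin 0 {0}ᶜ)
        (nhds ((r + 1) * |(0 : ℝ)| ^ r)) := by
      simpa [Real.zero_rpow hr.ne'] using (hc.tendsto 0).mono_left nhdsWithin_le_nhds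
    refine hlim.congr' ?_
    filter_upwards [self_mem_nhdsWithin] with s hs
    have hs : s ≠ 0 := hs
    simp [hs]
  · have ha : |t| ≠ 0 := abs_ne_zero.mpr ht
    refine ((hasDerivAt_id t).mul
      ((hasDerivAt_abs ht).rpow_const (p := r) (Or.inl ha))).congr_deriv ?_
    have h1 : t * (SignType.sign t : ℝ) = |t| := self_mul_sign t
    have h2 : |t| * |t| ^ (r - 1) = |t| ^ r := by
      rw [Real.rpow_sub_one ha]; field_simp
    simp only [id]
    linear_combination r * |t| ^ (r - 1) * h1 + r * h2

lemma contDiff_mul_abs_rpow {r : ℝ} (hr : 0 < r) :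
    ContDiff ℝ 1 fun s : ℝ => s * |s| ^ r := by
  refine contDiff_one_iff_deriv.2 ⟨fun t => (hasDerivAt_mul_abs_rpow hr t).differentiableAt, ?_⟩
  rw [funext fun t => (hasDerivAt_mul_abs_rpow hr t).deriv]
  exact continuous_const.mul (continuous_abs.rpow_const fun _ => Or.inr hr.le)

lemma abs_mul_abs_rpow (r t : ℝ) (hr : r + 1 ≠ 0) : |t * |t| ^ r| = |t| ^ (r + 1) := by
  rw [abs_mul, abs_of_nonneg (Real.rpow_nonneg (abs_nonneg t) r), mul_comm,
    Real.rpow_add_one' (abs_nonneg t) hr]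

lemma sign_mul_abs_rpow (r t : ℝ) : Real.sign (t * |t| ^ r) = Real.sign t := by
  rcases lt_trichotomy t 0 with ht | rfl | ht
  · rw [Real.sign_of_neg ht, Real.sign_of_neg
      (mul_neg_of_neg_of_pos ht (Real.rpow_pos_of_pos (abs_pos.2 ht.ne) r))]
  · simp
  · rw [Real.sign_of_pos ht, Real.sign_of_pos
      (mul_pos ht (Real.rpow_pos_of_pos (abs_pos.2 ht.ne') r))]

/-- The tangent line inequality for the convex function `t ↦ |t| ^ α`. -/
lemma abs_rpow_sub_le {α : ℝ} (hα : 1 < α) (a c : ℝ) :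
    |a| ^ α - α * c * (Real.sign a * |a| ^ (α - 1)) ≤ |a - c| ^ α := by
  have hα0 : 0 < α := by linarith
  have hy := Real.young_inequality_of_nonneg (abs_nonneg (a - c))
    (Real.rpow_nonneg (abs_nonneg a) (α - 1)) (Real.HolderConjugate.conjExponent hα)
  have he : (α - 1) * Real.conjExponent α = α := by
    have : α - 1 ≠ 0 := by linarith
    rw [Real.conjExponent]; field_simp
  rw [← Real.rpow_mul (abs_nonneg a), he] at hy
  have hconj : |a| ^ α / Real.conjExponent α = |a| ^ α - |a| ^ α / α := by
    have : α - 1 ≠ 0 := by linarith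
    rw [Real.conjExponent]; field_simp
  rw [hconj] at hy
  have hs : Real.sign a * (a - c) ≤ |a - c| := by
    rcases Real.sign_apply_eq a with h | h | h <;> rw [h]
    · linarith [neg_abs_le (a - c)]
    · simp
    · linarith [le_abs_self (a - c)]
  have hsa : Real.sign a * a * |a| ^ (α - 1) = |a| ^ α := by
    have h : Real.sign a * a = |a| := by
      rcases lt_trichotomy a 0 with ha | rfl | ha
      · rw [Real.sign_of_neg ha, abs_of_neg ha]; ring
      · simp
      · rw [Real.sign_of_pos ha, abs_of_pos ha]; ring
    rw [h, mul_comm, ← Real.rpow_add_one' (abs_nonneg a) (by linarith)]; ring_nf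
  have hm := (mul_le_mul_of_nonneg_right hs (Real.rpow_nonneg (abs_nonneg a) (α - 1))).trans hy
  have hm' : |a| ^ α / α - c * (Real.sign a * |a| ^ (α - 1)) ≤ |a - c| ^ α / α := by
    linear_combination hm - hsa
  calc _ = α * (|a| ^ α / α - c * (Real.sign a * |a| ^ (α - 1))) := by field_simp
    _ ≤ α * (|a - c| ^ α / α) := by gcongr
    _ = _ := by field_simp

lemma memLp_of_integrable_abs_rpow {X : Type*} [MeasurableSpace X] {μ : Measure X} {f : X → ℝ}
    {r : ℝ} (hr : 0 < r) (hf : AEStronglyMeasurable f μ)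
    (hi : Integrable (fun x => |f x| ^ r) μ) : MemLp f (ENNReal.ofReal r) μ := by
  rw [← integrable_norm_rpow_iff hf (by simpa using hr) ENNReal.ofReal_ne_top,
    ENNReal.toReal_ofReal hr.le]
  exact hi

lemma integrable_abs_sub_const_rpow {X : Type*} [MeasurableSpace X] {μ : Measure X}
    [IsFiniteMeasure μ] {f : X → ℝ} {r : ℝ} (hr : 0 < r) (hf : AEStronglyMeasurable f μ)
    (hi : Integrable (fun x => |f x| ^ r) μ) (c : ℝ) :
    Integrable (fun x => |f x - c| ^ r) μ := by
  have := ((memLp_of_integrable_abs_rpow hr hf hi).sub (memLp_const c)).integrable_norm_rpow'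
  rwa [ENNReal.toReal_ofReal hr.le] at this

/-- If `sgn g |g| ^ (α - 1)` has mean zero, then `0` is the best constant approximation of `g`
in `L^α`. -/
lemma integral_abs_rpow_le_integral_abs_sub_const {X : Type*} [MeasurableSpace X] {μ : Measure X}
    [IsFiniteMeasure μ] {g : X → ℝ} {α : ℝ} (hα : 1 < α) (hg : AEStronglyMeasurable g μ)
    (hi : Integrable (fun x => |g x| ^ α) μ)
    (h0 : ∫ x, Real.sign (g x) * |g x| ^ (α - 1) ∂μ = 0) (c : ℝ) :
    ∫ x, |g x| ^ α ∂μ ≤ ∫ x, |g x - c| ^ α ∂μ := by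
  have hα0 : 0 < α := by linarith
  have hi' : Integrable (fun x => |g x| ^ (α - 1)) μ :=
    integrable_norm_rpow_of_le hg (by linarith) hα0.le (by linarith) hi
  have hsign : Measurable Real.sign :=
    Measurable.ite measurableSet_Iio measurable_const
      (Measurable.ite measurableSet_Ioi measurable_const measurable_const)
  have his : Integrable (fun x => Real.sign (g x) * |g x| ^ (α - 1)) μ := by
    refine hi'.mono ((hsign.comp_aemeasurable hg.aemeasurable).aestronglyMeasurable.mul
      hi'.aestronglyMeasurable) (Filter.Eventually.of_forall fun x => ?_)
    rw [norm_mul]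
    refine mul_le_of_le_one_left (norm_nonneg _) ?_
    rcases Real.sign_apply_eq (g x) with h | h | h <;> simp [h]
  calc ∫ x, |g x| ^ α ∂μ
      = ∫ x, (|g x| ^ α - α * c * (Real.sign (g x) * |g x| ^ (α - 1))) ∂μ := by
        rw [integral_sub hi (his.const_mul _), integral_const_mul, h0]; simp
    _ ≤ ∫ x, |g x - c| ^ α ∂μ :=
        integral_mono (hi.sub (his.const_mul _)) (integrable_abs_sub_const_rpow hα0 hg hi c)
          fun x => abs_rpow_sub_le hα (g x) c

/-- Euclidean form of the first conclusion of Proposition 3.9: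
a Neumann α-Sobolev inequality on a finite-measure open set `Ω ⊆ ℝⁿ`
self-improves to an L^p-gradient Poincaré–Sobolev inequality
`‖f − k‖_{L^{αq}(Ω)} ≤ q·SN⁻¹·‖∇f‖_{L^p(Ω)}` for `q = p/(p−α(p−1))`,
where `k` is any constant with `∫ sgn(f−k)|f−k|^{q(α−1)} = 0`. -/
theorem neumann_sobolev_self_improvement
    (n : ℕ) (hn : 2 ≤ n) (Ω : Set (EuclideanSpace ℝ (Fin n))) (hΩ : IsOpen Ω)
    (hΩ0 : volume Ω ≠ 0) (hΩfin : volume Ω ≠ ⊤)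
    (α p SN q : ℝ) (hα1 : 1 < α) (hα2 : α ≤ (n : ℝ)/((n : ℝ) - 1))
    (hp : 1 < p) (hpα : 0 < p - α * (p - 1)) (hSN : 0 < SN)
    (hq : q = p / (p - α * (p - 1)))
    (H : ∀ g : EuclideanSpace ℝ (Fin n) → ℝ,
      ContDiffOn ℝ 1 g Ω →
      IntegrableOn (fun x => |g x| ^ α) Ω →
      IntegrableOn (fun x => ‖fderiv ℝ g x‖) Ω →
      (⨅ k : ℝ, (∫ x in Ω, |g x - k| ^ α) ^ (1/α))
        ≤ SN⁻¹ * ∫ x in Ω, ‖fderiv ℝ g x‖) :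
    ∀ f : EuclideanSpace ℝ (Fin n) → ℝ,
      ContDiffOn ℝ 1 f Ω →
      IntegrableOn (fun x => |f x| ^ (α * q)) Ω →
      IntegrableOn (fun x => ‖fderiv ℝ f x‖ ^ p) Ω →
      ∀ k : ℝ, (∫ x in Ω, Real.sign (f x - k) * |f x - k| ^ (q * (α - 1))) = 0 →
        (∫ x in Ω, |f x - k| ^ (α * q)) ^ (1/(α * q))
          ≤ q * SN⁻¹ * (∫ x in Ω, ‖fderiv ℝ f x‖ ^ p) ^ (1/p) := by
  intro f hf hfi hdi k hk
  have : IsFiniteMeasure (volume.restrict Ω) := isFiniteMeasure_restrict.2 hΩfin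
  have hα0 : 0 < α := by linarith
  have hp0 : 0 < p := by linarith
  have hp1 : p - 1 ≠ 0 := by linarith
  have hq1 : 1 < q := by
    rw [hq, one_lt_div hpα]
    nlinarith
  have hq0 : 0 < q := by linarith
  have hr : 0 < q - 1 := by linarith
  have hαq : 0 < α * q := by positivity
  have hpc : p.HolderConjugate (Real.conjExponent p) := Real.HolderConjugate.conjExponent hp
  have hexp : (q - 1) * Real.conjExponent p = α * q := by
    rw [Real.conjExponent, hq]; field_simp; ring
  have hexp' : 1 / α = 1 / (α * q) + 1 / Real.conjExponent p := by
    rw [Real.conjExponent, hq]; field_simp; ring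
  have hmeas : AEStronglyMeasurable f (volume.restrict Ω) :=
    hf.continuousOn.aestronglyMeasurable hΩ.measurableSet
  have hAi : IntegrableOn (fun x => |f x - k| ^ (α * q)) Ω :=
    integrable_abs_sub_const_rpow hαq hmeas hfi k
  set u : EuclideanSpace ℝ (Fin n) → ℝ := fun x => f x - k with hu
  have hucd : ContDiffOn ℝ 1 u Ω := hf.sub contDiffOn_const
  set g : EuclideanSpace ℝ (Fin n) → ℝ := fun x => u x * |u x| ^ (q - 1) with hg
  have hgcd : ContDiffOn ℝ 1 g Ω := (contDiff_mul_abs_rpow hr).comp_contDiffOn hucd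
  have hgabs : ∀ x, |g x| = |u x| ^ q := fun x => by
    rw [hg, abs_mul_abs_rpow _ _ (by linarith)]; ring_nf
  have hgα : ∀ x, |g x| ^ α = |u x| ^ (α * q) := fun x => by
    rw [hgabs, ← Real.rpow_mul (abs_nonneg _), mul_comm]
  have hgi : IntegrableOn (fun x => |g x| ^ α) Ω := by simpa only [hgα] using hAi
  have hgmeas : AEStronglyMeasurable g (volume.restrict Ω) :=
    hgcd.continuousOn.aestronglyMeasurable hΩ.measurableSet
  have hgd : Set.EqOn (fun x => ‖fderiv ℝ g x‖)
      (fun x => q * (‖fderiv ℝ f x‖ * |u x| ^ (q - 1))) Ω := by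
    intro x hx
    have hfd := ((hf.differentiableOn one_ne_zero).differentiableAt (hΩ.mem_nhds hx)).hasFDerivAt
    have h := ((hasDerivAt_mul_abs_rpow hr (u x)).comp_hasFDerivAt x (hfd.sub_const k)).fderiv
    change fderiv ℝ g x = _ at h
    simp only [h, norm_smul, norm_mul, Real.norm_eq_abs, sub_add_cancel, abs_of_pos hq0,
      abs_of_nonneg (Real.rpow_nonneg (abs_nonneg (u x)) (q - 1))]
    ring
  have hdL : MemLp (fun x => ‖fderiv ℝ f x‖) (ENNReal.ofReal p) (volume.restrict Ω) :=
    memLp_of_integrable_abs_rpow hp0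
      ((hf.continuousOn_fderiv_of_isOpen hΩ le_rfl).norm.aestronglyMeasurable hΩ.measurableSet)
      (by simp only [abs_norm]; exact hdi)
  have hpow : ∀ x, (|u x| ^ (q - 1)) ^ Real.conjExponent p = |u x| ^ (α * q) := fun x => by
    rw [← Real.rpow_mul (abs_nonneg _), hexp]
  have huL : MemLp (fun x => |u x| ^ (q - 1)) (ENNReal.ofReal (Real.conjExponent p))
      (volume.restrict Ω) := by
    refine memLp_of_integrable_abs_rpow hpc.symm.pos
      ((hucd.continuousOn.abs.rpow_const fun _ _ => Or.inr hr.le).aestronglyMeasurable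
        hΩ.measurableSet) ?_
    simp only [abs_of_nonneg (Real.rpow_nonneg (abs_nonneg _) _), hpow]
    exact hAi
  have hholder := integral_mul_le_Lp_mul_Lq_of_nonneg hpc
    (Filter.Eventually.of_forall fun x => norm_nonneg (fderiv ℝ f x))
    (Filter.Eventually.of_forall fun x => Real.rpow_nonneg (abs_nonneg (u x)) (q - 1)) hdL huL
  simp only [hpow] at hholder
  have : ENNReal.HolderConjugate (ENNReal.ofReal p) (ENNReal.ofReal (Real.conjExponent p)) :=
    hpc.ennrealOfReal
  have hgdi : IntegrableOn (fun x => ‖fderiv ℝ g x‖) Ω :=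
    IntegrableOn.congr_fun ((hdL.integrable_mul huL).const_mul q) hgd.symm hΩ.measurableSet
  have hmean : ∫ x in Ω, Real.sign (g x) * |g x| ^ (α - 1) = 0 := by
    rw [← hk]
    refine integral_congr_ae (Filter.Eventually.of_forall fun x => ?_)
    simp only [hgabs, ← Real.rpow_mul (abs_nonneg (u x))]
    rw [hg, sign_mul_abs_rpow]
  have hinf : (∫ x in Ω, |u x| ^ (α * q)) ^ (1 / α)
      ≤ ⨅ c : ℝ, (∫ x in Ω, |g x - c| ^ α) ^ (1 / α) := by
    refine le_ciInf fun c => ?_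
    have h := integral_abs_rpow_le_integral_abs_sub_const hα1 hgmeas hgi hmean c
    simp only [hgα] at h
    exact Real.rpow_le_rpow
      (integral_nonneg fun x => Real.rpow_nonneg (abs_nonneg _) _) h (by positivity)
  have hmain := hinf.trans (H g hgcd hgi hgdi)
  rw [setIntegral_congr_fun hΩ.measurableSet hgd, integral_const_mul] at hmain
  set A := ∫ x in Ω, |u x| ^ (α * q) with hA
  set D := ∫ x in Ω, ‖fderiv ℝ f x‖ ^ p with hD
  have hA0 : 0 ≤ A := integral_nonneg fun x => Real.rpow_nonneg (abs_nonneg _) _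
  have hD0 : 0 ≤ D := integral_nonneg fun x => Real.rpow_nonneg (norm_nonneg _) _
  rcases hA0.eq_or_lt with h0 | hApos
  · rw [← h0, Real.zero_rpow (by positivity)]
    positivity
  · have hApow : 0 < A ^ (1 / Real.conjExponent p) := Real.rpow_pos_of_pos hApos _
    refine le_of_mul_le_mul_right ?_ hApow
    calc A ^ (1 / (α * q)) * A ^ (1 / Real.conjExponent p)
        = A ^ (1 / α) := by rw [← Real.rpow_add hApos, hexp']
      _ ≤ SN⁻¹ * (q * (D ^ (1 / p) * A ^ (1 / Real.conjExponent p))) := by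
          refine hmain.trans ?_
          gcongr
      _ = _ := by ring
end

section
/- Let n ≥ 3, let B ⊆ ℝⁿ be an open ball, and let Λ > 0. Assume that for every C¹ function g : B → ℝ with g ∈ L^{n/(n−1)}(B) and |∇g| ∈ L¹(B) one has inf_{k∈ℝ} ‖g − k‖_{L^{n/(n−1)}(B)} ≤ Λ^{-1} ∫_B |∇g| dx. Then for every C¹ function f : B → ℝ with f ∈ Lⁿ(B) and |∇f| ∈ L^{n/2}(B), one has ( ⨍_B |f − f_B|ⁿ dx )^{1/n} ≤ (n−1)·Λ^{-1}·|B|^{1/n}·( ⨍_B |∇f|^{n/2} dx )^{2/n}, where f_B = ⨍_B f dx is the average of f over B. -/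
open MeasureTheory

/-- The signed power `t ↦ |t| ^ (m + 1) * t` has derivative `(m + 2) * |t| ^ (m + 1)`. -/
lemma hasDerivAt_abs_pow_succ_mul (m : ℕ) (t : ℝ) :
    HasDerivAt (fun s : ℝ => |s| ^ (m + 1) * s) (((m : ℝ) + 2) * |t| ^ (m + 1)) t := by
  have hne : ∀ s : ℝ, s ≠ 0 →
      HasDerivAt (fun s : ℝ => |s| ^ (m + 1) * s) (((m : ℝ) + 2) * |s| ^ (m + 1)) s := by
    intro s hs
    have h := ((hasDerivAt_abs hs).pow (m + 1)).mul (hasDerivAt_id s)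
    refine h.congr_deriv ?_
    have hsign : ((SignType.sign s : ℝ)) * s = |s| := by
      rw [mul_comm]; exact self_mul_sign s
    simp only [id, Pi.pow_apply, Nat.add_sub_cancel, mul_one]
    push_cast
    calc ((m : ℝ) + 1) * |s| ^ m * (SignType.sign s : ℝ) * s + |s| ^ (m + 1)
        = ((m : ℝ) + 1) * |s| ^ m * ((SignType.sign s : ℝ) * s) + |s| ^ (m + 1) := by ring
      _ = ((m : ℝ) + 2) * |s| ^ (m + 1) := by rw [hsign]; ring
  rcases eq_or_ne t 0 with rfl | ht
  · exact hasDerivAt_of_hasDerivAt_of_ne (fun y hy => hne y hy)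
      (by fun_prop) (by fun_prop)
  · exact hne t ht

lemma contDiff_abs_pow_succ_mul (m : ℕ) :
    ContDiff ℝ 1 (fun s : ℝ => |s| ^ (m + 1) * s) := by
  rw [contDiff_one_iff_deriv]
  refine ⟨fun t => (hasDerivAt_abs_pow_succ_mul m t).differentiableAt, ?_⟩
  rw [funext fun t => (hasDerivAt_abs_pow_succ_mul m t).deriv]
  fun_prop

/-- The tangent-line inequality for `|·| ^ (n / (n - 1))` at the signed power `|h| ^ (n - 2) * h`,
where `n = m + 3`. -/
lemma rpow_sub_mul_le_abs_signed_pow_sub_rpow (m : ℕ) (h k : ℝ) :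
    |h| ^ ((m : ℝ) + 3) - ((m : ℝ) + 3) / ((m : ℝ) + 2) * k * h
      ≤ |(|h| ^ (m + 1) * h) - k| ^ (((m : ℝ) + 3) / ((m : ℝ) + 2)) := by
  have hm : (0 : ℝ) ≤ m := m.cast_nonneg
  have hpq : (((m : ℝ) + 3) / ((m : ℝ) + 2)).HolderConjugate ((m : ℝ) + 3) := by
    rw [Real.holderConjugate_iff]
    constructor
    · rw [lt_div_iff₀ (by positivity)]; linarith
    · field_simp; ring
  have hy := Real.young_inequality ((|h| ^ (m + 1) * h) - k) h hpq
  have hpow : |h| ^ ((m : ℝ) + 3) = |h| ^ (m + 1) * h * h := by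
    rw [show (m : ℝ) + 3 = ((m + 3 : ℕ) : ℝ) by push_cast; ring, Real.rpow_natCast,
      show |h| ^ (m + 3) = |h| ^ (m + 1) * |h| ^ 2 by ring, sq_abs]
    ring
  set Z := |(|h| ^ (m + 1) * h) - k| ^ (((m : ℝ) + 3) / ((m : ℝ) + 2))
  have e : ((|h| ^ (m + 1) * h) - k) * h = |h| ^ ((m : ℝ) + 3) - k * h := by
    rw [hpow]; ring
  rw [e] at hy
  set W := |h| ^ ((m : ℝ) + 3)
  have h2 := mul_le_mul_of_nonneg_left hy
    (show (0 : ℝ) ≤ ((m : ℝ) + 3) / ((m : ℝ) + 2) by positivity)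
  have e1 : ((m : ℝ) + 3) / ((m : ℝ) + 2) *
      (Z / (((m : ℝ) + 3) / ((m : ℝ) + 2)) + W / ((m : ℝ) + 3)) = Z + W / ((m : ℝ) + 2) := by
    field_simp
  have e2 : ((m : ℝ) + 3) / ((m : ℝ) + 2) * (W - k * h)
      = W + W / ((m : ℝ) + 2) - ((m : ℝ) + 3) / ((m : ℝ) + 2) * k * h := by
    field_simp; ring
  rw [e1, e2] at h2
  linarith

lemma abs_signed_pow_rpow (m : ℕ) (h : ℝ) :
    |(|h| ^ (m + 1) * h)| ^ (((m : ℝ) + 3) / ((m : ℝ) + 2)) = |h| ^ ((m : ℝ) + 3) := by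
  have e : |(|h| ^ (m + 1) * h)| = |h| ^ ((m : ℝ) + 2) := by
    rw [abs_mul, abs_pow, abs_abs, ← pow_succ, ← Real.rpow_natCast]
    congr 1; push_cast; ring
  rw [e, ← Real.rpow_mul (abs_nonneg h)]
  congr 1
  have : (m : ℝ) + 2 ≠ 0 := by positivity
  field_simp

section FiniteMeasure

variable {α : Type*} [MeasurableSpace α] {μ : Measure α}

lemma memLp_ofReal_iff_integrable_abs_rpow {u : α → ℝ} (hu : AEStronglyMeasurable u μ)
    {p : ℝ} (hp : 0 < p) :
    MemLp u (ENNReal.ofReal p) μ ↔ Integrable (fun x => |u x| ^ p) μ := by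
  have := integrable_norm_rpow_iff hu (p := ENNReal.ofReal p) (by simpa using hp) (by simp)
  rw [ENNReal.toReal_ofReal hp.le] at this
  exact this.symm

/-- For `h` of mean zero, the best constant in `L ^ (n / (n - 1))` for the signed power
`|h| ^ (n - 2) * h` is zero, where `n = m + 3`. -/
lemma integral_abs_rpow_le_integral_abs_signed_pow_sub [IsFiniteMeasure μ] (m : ℕ) {h : α → ℝ}
    (hh : MemLp h (ENNReal.ofReal ((m : ℝ) + 3)) μ) (h0 : ∫ x, h x ∂μ = 0) (k : ℝ) :
    ∫ x, |h x| ^ ((m : ℝ) + 3) ∂μ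
      ≤ ∫ x, |(|h x| ^ (m + 1) * h x) - k| ^ (((m : ℝ) + 3) / ((m : ℝ) + 2)) ∂μ := by
  have hm : (0 : ℝ) ≤ m := m.cast_nonneg
  have hmeas := hh.aestronglyMeasurable
  have hint := (memLp_ofReal_iff_integrable_abs_rpow hmeas (by positivity)).1 hh
  have hint1 : Integrable h μ := hh.integrable (by
    rw [← ENNReal.ofReal_one]; exact ENNReal.ofReal_le_ofReal (by linarith))
  have hgm : AEStronglyMeasurable (fun x => |h x| ^ (m + 1) * h x) μ :=
    (contDiff_abs_pow_succ_mul m).continuous.comp_aestronglyMeasurable hmeas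
  have hp : (0 : ℝ) < ((m : ℝ) + 3) / ((m : ℝ) + 2) := by positivity
  have hg : MemLp (fun x => |h x| ^ (m + 1) * h x)
      (ENNReal.ofReal (((m : ℝ) + 3) / ((m : ℝ) + 2))) μ := by
    rw [memLp_ofReal_iff_integrable_abs_rpow hgm hp]
    simpa only [abs_signed_pow_rpow] using hint
  have hgk := hg.sub (memLp_const k)
  have hgki := (memLp_ofReal_iff_integrable_abs_rpow hgk.aestronglyMeasurable hp).1 hgk
  have hlin := hint1.const_mul (((m : ℝ) + 3) / ((m : ℝ) + 2) * k)
  calc ∫ x, |h x| ^ ((m : ℝ) + 3) ∂μ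
      = ∫ x, (|h x| ^ ((m : ℝ) + 3) - ((m : ℝ) + 3) / ((m : ℝ) + 2) * k * h x) ∂μ := by
        rw [integral_sub hint hlin, integral_const_mul, h0]; ring
    _ ≤ _ := integral_mono (hint.sub hlin) hgki
        fun x => rpow_sub_mul_le_abs_signed_pow_sub_rpow m (h x) k

/-- Hölder's inequality with exponents `n / (n - 2)` and `n / 2`, where `n = m + 3`. -/
lemma integral_abs_pow_mul_le (m : ℕ) {h G : α → ℝ}
    (hh : MemLp h (ENNReal.ofReal ((m : ℝ) + 3)) μ)
    (hG : MemLp G (ENNReal.ofReal (((m : ℝ) + 3) / 2)) μ) (hG0 : ∀ x, 0 ≤ G x) :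
    Integrable (fun x => |h x| ^ (m + 1) * G x) μ ∧
      ∫ x, |h x| ^ (m + 1) * G x ∂μ
        ≤ (∫ x, |h x| ^ ((m : ℝ) + 3) ∂μ) ^ (((m : ℝ) + 1) / ((m : ℝ) + 3)) *
          (∫ x, G x ^ (((m : ℝ) + 3) / 2) ∂μ) ^ (2 / ((m : ℝ) + 3)) := by
  have hm : (0 : ℝ) ≤ m := m.cast_nonneg
  have hpq : (((m : ℝ) + 3) / ((m : ℝ) + 1)).HolderConjugate (((m : ℝ) + 3) / 2) := by
    rw [Real.holderConjugate_iff]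
    constructor
    · rw [lt_div_iff₀ (by positivity)]; linarith
    · field_simp; ring
  have hmeas := hh.aestronglyMeasurable
  have hint := (memLp_ofReal_iff_integrable_abs_rpow hmeas (by positivity)).1 hh
  have e : ∀ x, (|h x| ^ (m + 1)) ^ (((m : ℝ) + 3) / ((m : ℝ) + 1)) = |h x| ^ ((m : ℝ) + 3) := by
    intro x
    rw [← Real.rpow_natCast, ← Real.rpow_mul (abs_nonneg _)]
    congr 1
    push_cast
    field_simp
  have hum : AEStronglyMeasurable (fun x => |h x| ^ (m + 1)) μ :=
    (show Continuous fun s : ℝ => |s| ^ (m + 1) by fun_prop).comp_aestronglyMeasurable hmeas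
  have hu : MemLp (fun x => |h x| ^ (m + 1))
      (ENNReal.ofReal (((m : ℝ) + 3) / ((m : ℝ) + 1))) μ := by
    rw [memLp_ofReal_iff_integrable_abs_rpow hum (by positivity)]
    simpa only [abs_pow, abs_abs, e] using hint
  constructor
  · have := hpq.ennrealOfReal
    exact hu.integrable_mul hG
  · have := integral_mul_le_Lp_mul_Lq_of_nonneg hpq
      (Filter.Eventually.of_forall fun x => by positivity)
      (Filter.Eventually.of_forall hG0) hu hG
    simpa only [e, one_div_div] using this

end FiniteMeasure

/-- Absorbing a power of `A` and rescaling to averages over a set of measure `V`. -/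
lemma average_rpow_le_of_rpow_le {N A D V C : ℝ} (hN : 2 < N) (hA : 0 ≤ A) (hD : 0 ≤ D)
    (hV : 0 < V) (hC : 0 ≤ C)
    (h : A ^ ((N - 1) / N) ≤ C * (A ^ ((N - 2) / N) * D ^ (2 / N))) :
    (V⁻¹ * A) ^ (1 / N) ≤ C * V ^ (1 / N) * (V⁻¹ * D) ^ (2 / N) := by
  have hN0 : 0 < N := by linarith
  have key : A ^ (1 / N) ≤ C * D ^ (2 / N) := by
    rcases hA.eq_or_lt with rfl | hA
    · rw [Real.zero_rpow (by positivity)]; positivity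
    · have hs : A ^ ((N - 1) / N) = A ^ ((N - 2) / N) * A ^ (1 / N) := by
        rw [← Real.rpow_add hA]; congr 1; field_simp; ring
      rw [hs] at h
      have hpos : 0 < A ^ ((N - 2) / N) := by positivity
      refine le_of_mul_le_mul_left ?_ hpos
      linarith
  rw [Real.mul_rpow (by positivity) hA, Real.mul_rpow (by positivity) hD]
  have hs : V ^ (1 / N) * V⁻¹ ^ (2 / N) = V⁻¹ ^ (1 / N) := by
    rw [Real.inv_rpow hV.le, Real.inv_rpow hV.le, ← Real.rpow_neg hV.le, ← Real.rpow_neg hV.le,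
      ← Real.rpow_add hV]
    congr 1; ring
  calc V⁻¹ ^ (1 / N) * A ^ (1 / N) ≤ V⁻¹ ^ (1 / N) * (C * D ^ (2 / N)) := by gcongr
    _ = C * V ^ (1 / N) * (V⁻¹ ^ (2 / N) * D ^ (2 / N)) := by rw [← hs]; ring

/-- Euclidean form of the first conclusion of the Poincaré lemma
from a Neumann–Sobolev constant: if every C¹ function on an open ball
`B ⊆ ℝⁿ` (`n ≥ 3`) satisfies `inf_k ‖g−k‖_{L^{n/(n−1)}(B)} ≤ Λ⁻¹ ∫_B |∇g|`,
then for every C¹ function `f` with `f ∈ Lⁿ(B)` and `|∇f| ∈ L^{n/2}(B)`,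
`(⨍_B |f − f_B|ⁿ)^{1/n} ≤ (n−1) Λ⁻¹ |B|^{1/n} (⨍_B |∇f|^{n/2})^{2/n}`. -/
theorem poincare_Ln_from_neumann_sobolev
    (n : ℕ) (hn : 3 ≤ n)
    (B : Set (EuclideanSpace ℝ (Fin n))) (x₀ : EuclideanSpace ℝ (Fin n))
    (r : ℝ) (hr : 0 < r) (hB : B = Metric.ball x₀ r)
    (Λ : ℝ) (hΛ : 0 < Λ)
    (H : ∀ g : EuclideanSpace ℝ (Fin n) → ℝ,
      ContDiffOn ℝ 1 g B →
      IntegrableOn (fun x => |g x| ^ ((n : ℝ)/((n : ℝ) - 1))) B →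
      IntegrableOn (fun x => ‖fderiv ℝ g x‖) B →
      (⨅ k : ℝ, (∫ x in B, |g x - k| ^ ((n : ℝ)/((n : ℝ) - 1))) ^ (((n : ℝ) - 1)/(n : ℝ)))
        ≤ Λ⁻¹ * ∫ x in B, ‖fderiv ℝ g x‖) :
    ∀ f : EuclideanSpace ℝ (Fin n) → ℝ,
      ContDiffOn ℝ 1 f B →
      IntegrableOn (fun x => |f x| ^ (n : ℝ)) B →
      IntegrableOn (fun x => ‖fderiv ℝ f x‖ ^ ((n : ℝ)/2)) B →
      ((volume B).toReal⁻¹ *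
          ∫ x in B, |f x - (volume B).toReal⁻¹ * ∫ y in B, f y| ^ (n : ℝ)) ^ (1/(n : ℝ))
        ≤ ((n : ℝ) - 1) * Λ⁻¹ * (volume B).toReal ^ (1/(n : ℝ)) *
          ((volume B).toReal⁻¹ * ∫ x in B, ‖fderiv ℝ f x‖ ^ ((n : ℝ)/2)) ^ (2/(n : ℝ)) := by
  intro f hf hfi hGi
  obtain ⟨m, rfl⟩ : ∃ m, n = m + 3 := ⟨n - 3, by omega⟩
  have hm : (0 : ℝ) ≤ m := m.cast_nonneg
  have hcast : ((m + 3 : ℕ) : ℝ) = (m : ℝ) + 3 := by push_cast; ring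
  have hcast1 : (m : ℝ) + 3 - 1 = (m : ℝ) + 2 := by ring
  simp only [hcast, hcast1] at H hfi hGi ⊢
  have hBo : IsOpen B := hB ▸ Metric.isOpen_ball
  have hBm : MeasurableSet B := hBo.measurableSet
  have hBfin : volume B < ⊤ := hB ▸ measure_ball_lt_top
  have hBpos : 0 < volume B := hB ▸ Metric.measure_ball_pos volume x₀ hr
  have : IsFiniteMeasure (volume.restrict B) := ⟨by simpa using hBfin⟩
  have hV : 0 < (volume B).toReal := ENNReal.toReal_pos hBpos.ne' hBfin.ne
  have hfm : AEStronglyMeasurable f (volume.restrict B) :=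
    hf.continuousOn.aestronglyMeasurable hBm
  have hGm : AEStronglyMeasurable (fun x => ‖fderiv ℝ f x‖) (volume.restrict B) :=
    (hf.continuousOn_fderiv_of_isOpen hBo le_rfl).norm.aestronglyMeasurable hBm
  have hfL : MemLp f (ENNReal.ofReal ((m : ℝ) + 3)) (volume.restrict B) :=
    (memLp_ofReal_iff_integrable_abs_rpow hfm (by positivity)).2 hfi
  have hGL : MemLp (fun x => ‖fderiv ℝ f x‖) (ENNReal.ofReal (((m : ℝ) + 3) / 2))
      (volume.restrict B) :=
    (memLp_ofReal_iff_integrable_abs_rpow hGm (by positivity)).2 (by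
      simpa only [abs_norm, IntegrableOn] using hGi)
  have hf1 : Integrable f (volume.restrict B) := hfL.integrable (by
    rw [← ENNReal.ofReal_one]; exact ENNReal.ofReal_le_ofReal (by linarith))
  set c := (volume B).toReal⁻¹ * ∫ y in B, f y with hc
  have hhL : MemLp (fun x => f x - c) (ENNReal.ofReal ((m : ℝ) + 3)) (volume.restrict B) :=
    hfL.sub (memLp_const c)
  have hhi := (memLp_ofReal_iff_integrable_abs_rpow hhL.aestronglyMeasurable (by positivity)).1 hhL
  have h0 : ∫ x in B, (f x - c) = 0 := by
    rw [integral_sub hf1 (integrable_const c), setIntegral_const, measureReal_def, smul_eq_mul, hc]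
    field_simp
    ring
  obtain ⟨hprod, hholder⟩ := integral_abs_pow_mul_le m hhL hGL fun x => norm_nonneg _
  set g := fun x => |f x - c| ^ (m + 1) * (f x - c) with hg
  have hgd : ContDiffOn ℝ 1 g B :=
    (contDiff_abs_pow_succ_mul m).comp_contDiffOn (hf.sub contDiffOn_const)
  have hfd : ∀ x ∈ B,
      ‖fderiv ℝ g x‖ = ((m : ℝ) + 2) * (|f x - c| ^ (m + 1) * ‖fderiv ℝ f x‖) := by
    intro x hx
    have hd : HasFDerivAt f (fderiv ℝ f x) x :=
      ((hf.differentiableOn one_ne_zero).differentiableAt (hBo.mem_nhds hx)).hasFDerivAt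
    have h1 : HasFDerivAt g ((((m : ℝ) + 2) * |f x - c| ^ (m + 1)) • fderiv ℝ f x) x :=
      HasDerivAt.comp_hasFDerivAt (h₂ := fun s : ℝ => |s| ^ (m + 1) * s) x
        (hasDerivAt_abs_pow_succ_mul m (f x - c)) (hd.sub_const c)
    rw [h1.fderiv, norm_smul, Real.norm_of_nonneg (by positivity)]
    ring
  have hgradint : IntegrableOn (fun x => ‖fderiv ℝ g x‖) B :=
    (integrableOn_congr_fun hfd hBm).2 (hprod.const_mul _)
  have hgint : IntegrableOn (fun x => |g x| ^ (((m : ℝ) + 3) / ((m : ℝ) + 2))) B := by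
    simpa only [hg, abs_signed_pow_rpow, IntegrableOn] using hhi
  have hmain := H g hgd hgint hgradint
  rw [setIntegral_congr_fun hBm hfd, integral_const_mul] at hmain
  have hlow : (∫ x in B, |f x - c| ^ ((m : ℝ) + 3)) ^ (((m : ℝ) + 2) / ((m : ℝ) + 3)) ≤
      ⨅ k : ℝ, (∫ x in B, |g x - k| ^ (((m : ℝ) + 3) / ((m : ℝ) + 2))) ^
        (((m : ℝ) + 2) / ((m : ℝ) + 3)) :=
    le_ciInf fun k => Real.rpow_le_rpow (integral_nonneg fun x => by positivity)
      (integral_abs_rpow_le_integral_abs_signed_pow_sub m hhL h0 k) (by positivity)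
  refine average_rpow_le_of_rpow_le (by linarith) (integral_nonneg fun x => by positivity)
    (integral_nonneg fun x => by positivity) hV (by positivity) ?_
  rw [show (m : ℝ) + 3 - 1 = (m : ℝ) + 2 by ring, show (m : ℝ) + 3 - 2 = (m : ℝ) + 1 by ring]
  calc _ ≤ Λ⁻¹ * (((m : ℝ) + 2) * ∫ x in B, |f x - c| ^ (m + 1) * ‖fderiv ℝ f x‖) :=
        hlow.trans hmain
    _ ≤ Λ⁻¹ * (((m : ℝ) + 2) * _) :=
        mul_le_mul_of_nonneg_left (mul_le_mul_of_nonneg_left hholder (by positivity))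
          (by positivity)
    _ = _ := by ring
end

section
/- Let n ≥ 3, let B ⊆ ℝⁿ be an open ball, let Λ > 0, and let p ≥ n/2. Assume that for every C¹ function g : B → ℝ with g ∈ L^{n/(n−1)}(B) and |∇g| ∈ L¹(B) one has inf_{k∈ℝ} ‖g − k‖_{L^{n/(n−1)}(B)} ≤ Λ^{-1} ∫_B |∇g| dx. Then for every C¹ function f : B → ℝ with f ∈ Lⁿ(B) and |∇f| ∈ L^p(B), one has ⨍_B |f − f_B| dx ≤ (n−1)·Λ^{-1}·|B|^{1/n}·( ⨍_B |∇f|^p dx )^{1/p}, where f_B = ⨍_B f dx is the average of f over B. -/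
open MeasureTheory

/-- Hölder's inequality against the constant function `1` on a finite measure space. -/
lemma integral_abs_le_measureReal_rpow_mul {α : Type*} [MeasurableSpace α] {μ : Measure α}
    [IsFiniteMeasure μ] {s t : ℝ} (hst : s.HolderConjugate t) {g : α → ℝ}
    (hg : MemLp g (ENNReal.ofReal s) μ) :
    ∫ x, |g x| ∂μ ≤ μ.real Set.univ ^ (1 / t) * (∫ x, |g x| ^ s ∂μ) ^ (1 / s) := by
  have h := integral_mul_le_Lp_mul_Lq_of_nonneg hst (μ := μ) (f := fun x => |g x|)
    (g := fun _ => (1 : ℝ)) (Filter.Eventually.of_forall fun x => abs_nonneg (g x))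
    (Filter.Eventually.of_forall fun _ => zero_le_one) hg.abs (memLp_const 1)
  simpa [mul_comm] using h

/-- The mean oscillation about the average is at most twice the one about any constant. -/
lemma integral_abs_sub_average_le {α : Type*} [MeasurableSpace α] {μ : Measure α}
    [IsFiniteMeasure μ] (hμ : 0 < μ.real Set.univ) {f : α → ℝ} (hf : Integrable f μ) (k : ℝ) :
    ∫ x, |f x - (μ.real Set.univ)⁻¹ * ∫ y, f y ∂μ| ∂μ ≤ 2 * ∫ x, |f x - k| ∂μ := by
  have hk : Integrable (fun x => f x - k) μ := hf.sub (integrable_const k)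
  set m := (μ.real Set.univ)⁻¹ * ∫ y, f y ∂μ with hm
  have hmean : μ.real Set.univ * |k - m| = |∫ x, (f x - k) ∂μ| := by
    rw [integral_sub hf (integrable_const k), integral_const, smul_eq_mul, abs_sub_comm k m,
      ← abs_of_pos hμ, ← abs_mul, abs_of_pos hμ, mul_sub, hm, mul_inv_cancel_left₀ hμ.ne']
  calc ∫ x, |f x - m| ∂μ ≤ ∫ x, (|f x - k| + |k - m|) ∂μ :=
        integral_mono (hf.sub (integrable_const m)).abs (hk.abs.add (integrable_const _))
          fun x => abs_sub_le (f x) k m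
    _ = (∫ x, |f x - k| ∂μ) + |∫ x, (f x - k) ∂μ| := by
        rw [integral_add hk.abs (integrable_const _), integral_const, smul_eq_mul, hmean]
    _ ≤ 2 * ∫ x, |f x - k| ∂μ := by
        linarith [abs_integral_le_integral_abs (μ := μ) (f := fun x => f x - k)]

/-- A measurable function whose `s`-th power is integrable belongs to `L^t` for every `t ≤ s`
on a finite measure space. -/
lemma memLp_of_integrable_abs_rpow_s9 {α : Type*} [MeasurableSpace α] {μ : Measure α}
    [IsFiniteMeasure μ] {s t : ℝ} (hs : 0 < s) (hts : t ≤ s) {g : α → ℝ}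
    (hm : AEStronglyMeasurable g μ) (hg : Integrable (fun x => |g x| ^ s) μ) :
    MemLp g (ENNReal.ofReal t) μ := by
  have h : MemLp g (ENNReal.ofReal s) μ := by
    rw [← integrable_norm_rpow_iff hm (by simpa using hs) ENNReal.ofReal_ne_top,
      ENNReal.toReal_ofReal hs.le]
    exact hg
  exact h.mono_exponent (ENNReal.ofReal_le_ofReal hts)

/-- Euclidean form of the second conclusion of the Poincaré lemma
from a Neumann–Sobolev constant: if every C¹ function on an open ball
`B ⊆ ℝⁿ` (`n ≥ 3`) satisfies `inf_k ‖g−k‖_{L^{n/(n−1)}(B)} ≤ Λ⁻¹ ∫_B |∇g|`,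
then for every `p ≥ n/2` and every C¹ function `f` with `f ∈ Lⁿ(B)` and
`|∇f| ∈ L^p(B)`,
`⨍_B |f − f_B| ≤ (n−1) Λ⁻¹ |B|^{1/n} (⨍_B |∇f|^p)^{1/p}`. -/
theorem poincare_1p_from_neumann_sobolev
    (n : ℕ) (hn : 3 ≤ n)
    (B : Set (EuclideanSpace ℝ (Fin n))) (x₀ : EuclideanSpace ℝ (Fin n))
    (r : ℝ) (hr : 0 < r) (hB : B = Metric.ball x₀ r)
    (Λ p : ℝ) (hΛ : 0 < Λ) (hp : (n : ℝ)/2 ≤ p)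
    (H : ∀ g : EuclideanSpace ℝ (Fin n) → ℝ,
      ContDiffOn ℝ 1 g B →
      IntegrableOn (fun x => |g x| ^ ((n : ℝ)/((n : ℝ) - 1))) B →
      IntegrableOn (fun x => ‖fderiv ℝ g x‖) B →
      (⨅ k : ℝ, (∫ x in B, |g x - k| ^ ((n : ℝ)/((n : ℝ) - 1))) ^ (((n : ℝ) - 1)/(n : ℝ)))
        ≤ Λ⁻¹ * ∫ x in B, ‖fderiv ℝ g x‖) :
    ∀ f : EuclideanSpace ℝ (Fin n) → ℝ,
      ContDiffOn ℝ 1 f B →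
      IntegrableOn (fun x => |f x| ^ (n : ℝ)) B →
      IntegrableOn (fun x => ‖fderiv ℝ f x‖ ^ p) B →
      (volume B).toReal⁻¹ *
          ∫ x in B, |f x - (volume B).toReal⁻¹ * ∫ y in B, f y|
        ≤ ((n : ℝ) - 1) * Λ⁻¹ * (volume B).toReal ^ (1/(n : ℝ)) *
          ((volume B).toReal⁻¹ * ∫ x in B, ‖fderiv ℝ f x‖ ^ p) ^ (1/p) := by
  intro f hf hfn hfp
  have hn' : (3 : ℝ) ≤ n := by exact_mod_cast hn
  have hn0 : (0 : ℝ) < n := by linarith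
  have hn1 : (0 : ℝ) < n - 1 := by linarith
  have hBo : IsOpen B := hB ▸ Metric.isOpen_ball
  have hBfin : volume B ≠ ⊤ := by rw [hB]; exact measure_ball_lt_top.ne
  have hV : 0 < (volume B).toReal := by
    refine ENNReal.toReal_pos ?_ hBfin
    rw [hB]
    exact (Metric.measure_ball_pos volume x₀ hr).ne'
  have : IsFiniteMeasure (volume.restrict B) := isFiniteMeasure_restrict.2 hBfin
  have hVr : (volume.restrict B).real Set.univ = (volume B).toReal := by
    simp [Measure.real]
  have hfm : AEStronglyMeasurable f (volume.restrict B) :=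
    hf.continuousOn.aestronglyMeasurable hBo.measurableSet
  have hdm : AEStronglyMeasurable (fun x => ‖fderiv ℝ f x‖) (volume.restrict B) :=
    ((hf.continuousOn_fderiv_of_isOpen hBo le_rfl).norm).aestronglyMeasurable hBo.measurableSet
  have hp1 : 1 < p := by linarith
  set q : ℝ := (n : ℝ) / ((n : ℝ) - 1) with hq
  have hq1 : 1 < q := by rw [hq, lt_div_iff₀ hn1]; linarith
  have hqn : q ≤ n := by rw [hq, div_le_iff₀ hn1]; nlinarith
  have hconj : q.HolderConjugate n := by
    rw [Real.holderConjugate_iff]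
    refine ⟨hq1, ?_⟩
    rw [hq]
    field_simp
    ring
  have hfq : MemLp f (ENNReal.ofReal q) (volume.restrict B) :=
    memLp_of_integrable_abs_rpow_s9 hn0 hqn hfm hfn
  have hdp : MemLp (fun x => ‖fderiv ℝ f x‖) (ENNReal.ofReal p) (volume.restrict B) :=
    memLp_of_integrable_abs_rpow_s9 (by linarith) le_rfl hdm (by simpa [IntegrableOn] using hfp)
  have hfint : Integrable f (volume.restrict B) :=
    hfq.integrable (by simpa using hq1.le)
  have hdint : IntegrableOn (fun x => ‖fderiv ℝ f x‖) B :=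
    hdp.integrable (by simpa using hp1.le)
  have hfqint : IntegrableOn (fun x => |f x| ^ q) B := by
    have h := hfq.integrable_norm_rpow (by simpa using zero_lt_one.trans hq1) ENNReal.ofReal_ne_top
    rwa [ENNReal.toReal_ofReal (by linarith)] at h
  have hH := H f hf hfqint hdint
  set V := (volume B).toReal with hVdef
  set D := ∫ x in B, ‖fderiv ℝ f x‖ with hD
  set O := ∫ x in B, |f x - V⁻¹ * ∫ y in B, f y| with hO
  have hVn : 0 < V ^ (1 / (n : ℝ)) := Real.rpow_pos_of_pos hV _
  have hosc : O ≤ 2 * V ^ (1 / (n : ℝ)) * (Λ⁻¹ * D) := by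
    rw [← div_le_iff₀' (by positivity)]
    refine le_trans (le_ciInf fun k => ?_) hH
    rw [div_le_iff₀' (by positivity)]
    have h1 := integral_abs_sub_average_le (by rwa [hVr]) hfint k
    have h2 := integral_abs_le_measureReal_rpow_mul hconj (hfq.sub (memLp_const k))
    rw [hVr] at h1 h2
    have hq' : 1 / q = ((n : ℝ) - 1) / n := by rw [hq, one_div_div]
    rw [hq'] at h2
    simp only [Pi.sub_apply] at h2
    linarith
  have hDp : V⁻¹ * D ≤ (V⁻¹ * ∫ x in B, ‖fderiv ℝ f x‖ ^ p) ^ (1 / p) := by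
    have h := integral_abs_le_measureReal_rpow_mul (Real.HolderConjugate.conjExponent hp1) hdp
    simp only [abs_norm, hVr] at h
    have he : 1 / p.conjExponent = 1 - 1 / p := by
      have := (Real.HolderConjugate.conjExponent hp1).inv_add_inv_eq_one
      simp only [one_div]; linarith
    rw [he, Real.rpow_sub hV, Real.rpow_one] at h
    rw [Real.mul_rpow (by positivity) (by positivity), Real.inv_rpow hV.le]
    calc V⁻¹ * D ≤ V⁻¹ * (V / V ^ (1 / p) * (∫ x in B, ‖fderiv ℝ f x‖ ^ p) ^ (1 / p)) := by
          gcongr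
      _ = _ := by field_simp
  calc V⁻¹ * O ≤ V⁻¹ * (2 * V ^ (1 / (n : ℝ)) * (Λ⁻¹ * D)) := by gcongr
    _ = 2 * Λ⁻¹ * V ^ (1 / (n : ℝ)) * (V⁻¹ * D) := by ring
    _ ≤ _ := by
        gcongr
        linarith
end

section
/- Let f : ℝ³ → ℝ be a smooth function with compact support. Then ∫_{ℝ³} |∇²f|³ dx ≤ 5 ∫_{ℝ³} |∇f|·|∇²f|·|∇³f| dx. -/
open MeasureTheory

/-- The Euclidean (Hilbert–Schmidt) norm of the `k`-th derivative of
`f : ℝ³ → ℝ` at `x`: the square root of the sum of squares of all the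
`k`-th partial derivatives, i.e. of the values of the `k`-th iterated
Fréchet derivative on tuples of standard basis vectors. -/
noncomputable def hsNormDeriv (k : ℕ) (f : EuclideanSpace ℝ (Fin 3) → ℝ)
    (x : EuclideanSpace ℝ (Fin 3)) : ℝ :=
  Real.sqrt (∑ m : Fin k → Fin 3,
    (iteratedFDeriv ℝ k f x (fun i => EuclideanSpace.single (m i) (1 : ℝ))) ^ 2)

section TensorInequality

variable {ι : Type*} [Fintype ι]

theorem sum_sum_mul_le_sqrt_mul_sqrt (a b : ι → ι → ℝ) :
    ∑ i, ∑ j, a i j * b i j ≤ √(∑ i, ∑ j, a i j ^ 2) * √(∑ i, ∑ j, b i j ^ 2) := by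
  simpa only [Fintype.sum_prod_type] using
    Real.sum_mul_le_sqrt_mul_sqrt Finset.univ (fun q : ι × ι => a q.1 q.2) (fun q => b q.1 q.2)

theorem sq_sum_sum_mul_le (a b : ι → ι → ℝ) :
    (∑ i, ∑ j, a i j * b i j) ^ 2 ≤ (∑ i, ∑ j, a i j ^ 2) * ∑ i, ∑ j, b i j ^ 2 := by
  simpa only [Fintype.sum_prod_type] using
    Finset.sum_mul_sq_le_sq_mul_sq Finset.univ (fun q : ι × ι => a q.1 q.2) (fun q => b q.1 q.2)

/-- Pointwise bound for the contraction of a vector `p` with the divergence of `g • H`, where `T`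
is the derivative of the matrix field `H` and `g` is a regularization of its norm. -/
theorem neg_sum_divergence_mul_le (p : ι → ℝ) (H : ι → ι → ℝ) (T : ι → ι → ι → ℝ) {g : ℝ}
    (hg : 0 < g) (hH : √(∑ i, ∑ j, H i j ^ 2) ≤ g) :
    -∑ i, ∑ j, ((∑ k, ∑ l, H k l * T i k l) / g * H i j + g * T i i j) * p j
      ≤ (1 + √(Fintype.card ι)) *
        (√(∑ i, p i ^ 2) * g * √(∑ i, ∑ k, ∑ l, T i k l ^ 2)) := by
  set W : ι → ℝ := fun i => (∑ k, ∑ l, H k l * T i k l) / g with hW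
  have hH2 : ∑ i, ∑ j, H i j ^ 2 ≤ g ^ 2 := (Real.sqrt_le_left hg.le).1 hH
  have hWT : ∑ i, W i ^ 2 ≤ ∑ i, ∑ k, ∑ l, T i k l ^ 2 := by
    refine Finset.sum_le_sum fun i _ => ?_
    rw [hW, div_pow, div_le_iff₀ (by positivity), mul_comm]
    exact (sq_sum_sum_mul_le H (T i)).trans (by gcongr)
  have hdiag : ∑ i, ∑ j, T i i j ^ 2 ≤ ∑ i, ∑ k, ∑ l, T i k l ^ 2 :=
    Finset.sum_le_sum fun i _ =>
      Finset.single_le_sum (f := fun k => ∑ l, T i k l ^ 2) (fun k _ => by positivity)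
        (Finset.mem_univ i)
  have h1 : ∑ i, ∑ j, (-W i * p j) * H i j
      ≤ √(∑ i, p i ^ 2) * g * √(∑ i, ∑ k, ∑ l, T i k l ^ 2) := by
    refine (sum_sum_mul_le_sqrt_mul_sqrt (fun i j => -W i * p j) H).trans ?_
    have : ∑ i, ∑ j, (-W i * p j) ^ 2 = (∑ i, W i ^ 2) * ∑ j, p j ^ 2 := by
      simp [Finset.sum_mul_sum, mul_pow]
    rw [this, Real.sqrt_mul (by positivity)]
    calc _ ≤ √(∑ i, ∑ k, ∑ l, T i k l ^ 2) * √(∑ i, p i ^ 2) * g := by gcongr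
      _ = _ := by ring
  have h2 : ∑ i, ∑ j, (-p j) * T i i j
      ≤ √(Fintype.card ι) * √(∑ i, p i ^ 2) * √(∑ i, ∑ k, ∑ l, T i k l ^ 2) := by
    refine (sum_sum_mul_le_sqrt_mul_sqrt (fun _ j => -p j) fun i j => T i i j).trans ?_
    have : ∑ _i : ι, ∑ j, (-p j) ^ 2 = Fintype.card ι * ∑ j, p j ^ 2 := by simp
    rw [this, Real.sqrt_mul (by positivity)]
    gcongr
  have key : -∑ i, ∑ j, (W i * H i j + g * T i i j) * p j
      = ∑ i, ∑ j, (-W i * p j) * H i j + g * ∑ i, ∑ j, (-p j) * T i i j := by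
    simp only [Finset.mul_sum, ← Finset.sum_add_distrib, ← Finset.sum_neg_distrib]
    exact Finset.sum_congr rfl fun i _ => Finset.sum_congr rfl fun j _ => by ring
  rw [key]
  nlinarith [mul_le_mul_of_nonneg_left h2 hg.le]

end TensorInequality

section PartialDeriv

/-- The partial derivative in the `i`-th coordinate direction. -/
noncomputable def partialDeriv {n : ℕ} (i : Fin n) (f : EuclideanSpace ℝ (Fin n) → ℝ)
    (x : EuclideanSpace ℝ (Fin n)) : ℝ :=
  fderiv ℝ f x (EuclideanSpace.single i 1)

variable {n : ℕ} {f : EuclideanSpace ℝ (Fin n) → ℝ}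

protected theorem ContDiff.partialDeriv (hf : ContDiff ℝ (⊤ : ℕ∞) f) (i : Fin n) :
    ContDiff ℝ (⊤ : ℕ∞) (partialDeriv i f) :=
  (hf.fderiv_right (m := (⊤ : ℕ∞)) (by simp)).clm_apply contDiff_const

protected theorem HasCompactSupport.partialDeriv (hf : HasCompactSupport f) (i : Fin n) :
    HasCompactSupport (partialDeriv i f) :=
  hf.fderiv_apply ℝ _

theorem iteratedFDeriv_succ_single (hf : ContDiff ℝ (⊤ : ℕ∞) f) (k : ℕ)
    (m : Fin (k + 1) → Fin n) (x : EuclideanSpace ℝ (Fin n)) :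
    iteratedFDeriv ℝ (k + 1) f x (fun i => EuclideanSpace.single (m i) (1 : ℝ))
      = partialDeriv (m 0) (fun y => iteratedFDeriv ℝ k f y
          fun i => EuclideanSpace.single (m i.succ) (1 : ℝ)) x := by
  have hd : DifferentiableAt ℝ (iteratedFDeriv ℝ k f) x :=
    (hf.differentiable_iteratedFDeriv (by exact_mod_cast WithTop.coe_lt_top k)) x
  rw [partialDeriv, fderiv_continuousMultilinear_apply_const_apply hd]
  rfl

/-- Integration by parts in a coordinate direction, for smooth functions of which the second one has
compact support. -/
theorem integral_mul_partialDeriv {u v : EuclideanSpace ℝ (Fin n) → ℝ}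
    (hu : ContDiff ℝ (⊤ : ℕ∞) u) (hv : ContDiff ℝ (⊤ : ℕ∞) v) (hvs : HasCompactSupport v)
    (i : Fin n) :
    ∫ x, u x * partialDeriv i v x = -∫ x, partialDeriv i u x * v x :=
  integral_mul_fderiv_eq_neg_fderiv_mul_of_integrable
    (((hu.partialDeriv i).continuous.mul hv.continuous).integrable_of_hasCompactSupport
      hvs.mul_left)
    ((hu.continuous.mul (hv.partialDeriv i).continuous).integrable_of_hasCompactSupport
      (hvs.partialDeriv i).mul_left)
    ((hu.continuous.mul hv.continuous).integrable_of_hasCompactSupport hvs.mul_left)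
    (fun x _ => (hu.differentiable (by simp)) x) (fun x _ => (hv.differentiable (by simp)) x)

end PartialDeriv

section HilbertSchmidt

theorem sum_fin_succ_pi {α M : Type*} [Fintype α] [AddCommMonoid M] {k : ℕ}
    (F : (Fin (k + 1) → α) → M) :
    ∑ m, F m = ∑ i, ∑ m : Fin k → α, F (Fin.cons i m) := by
  rw [← (Fin.consEquiv fun _ => α).sum_comp, Fintype.sum_prod_type]
  rfl

variable {f : EuclideanSpace ℝ (Fin 3) → ℝ}

theorem hsNormDeriv_nonneg (k : ℕ) (f : EuclideanSpace ℝ (Fin 3) → ℝ)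
    (x : EuclideanSpace ℝ (Fin 3)) : 0 ≤ hsNormDeriv k f x :=
  Real.sqrt_nonneg _

theorem hsNormDeriv_one (hf : ContDiff ℝ (⊤ : ℕ∞) f) (x : EuclideanSpace ℝ (Fin 3)) :
    hsNormDeriv 1 f x = √(∑ i, partialDeriv i f x ^ 2) := by
  simp [hsNormDeriv, sum_fin_succ_pi, iteratedFDeriv_succ_single hf]

theorem hsNormDeriv_two (hf : ContDiff ℝ (⊤ : ℕ∞) f) (x : EuclideanSpace ℝ (Fin 3)) :
    hsNormDeriv 2 f x = √(∑ i, ∑ j, partialDeriv i (partialDeriv j f) x ^ 2) := by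
  simp [hsNormDeriv, sum_fin_succ_pi, iteratedFDeriv_succ_single hf]

theorem hsNormDeriv_three (hf : ContDiff ℝ (⊤ : ℕ∞) f) (x : EuclideanSpace ℝ (Fin 3)) :
    hsNormDeriv 3 f x
      = √(∑ i, ∑ j, ∑ k, partialDeriv i (partialDeriv j (partialDeriv k f)) x ^ 2) := by
  have h (m : Fin 0 → Fin 3) (i j k : Fin 3) :
      (Fin.cons i (Fin.cons j (Fin.cons k m)) : Fin 3 → Fin 3) 2 = k := rfl
  simp [hsNormDeriv, sum_fin_succ_pi, iteratedFDeriv_succ_single hf, h]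

theorem continuous_hsNormDeriv (hf : ContDiff ℝ (⊤ : ℕ∞) f) (k : ℕ) :
    Continuous (hsNormDeriv k f) := by
  refine Real.continuous_sqrt.comp (continuous_finsetSum _ fun m _ => Continuous.pow ?_ 2)
  have h := hf.continuous_iteratedFDeriv (m := k) (by exact_mod_cast le_top)
  exact (ContinuousMultilinearMap.apply ℝ _ ℝ _).continuous.comp h

protected theorem HasCompactSupport.hsNormDeriv (hf : HasCompactSupport f) (k : ℕ) :
    HasCompactSupport (hsNormDeriv k f) :=
  (hf.iteratedFDeriv (𝕜 := ℝ) k).mono fun x hx h0 => hx (by simp [_root_.hsNormDeriv, h0])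

end HilbertSchmidt

section Regularization

/-- A smooth positive regularization of the Hilbert–Schmidt norm of the Hessian. -/
noncomputable def regHessianNorm {n : ℕ} (ε : ℝ) (f : EuclideanSpace ℝ (Fin n) → ℝ)
    (x : EuclideanSpace ℝ (Fin n)) : ℝ :=
  √(ε ^ 2 + ∑ i, ∑ j, partialDeriv i (partialDeriv j f) x ^ 2)

variable {n : ℕ} {f : EuclideanSpace ℝ (Fin n) → ℝ} {ε : ℝ}

theorem regHessianNorm_pos (hε : 0 < ε) (x : EuclideanSpace ℝ (Fin n)) :
    0 < regHessianNorm ε f x :=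
  Real.sqrt_pos.2 (by positivity)

theorem contDiff_regHessianNorm (hf : ContDiff ℝ (⊤ : ℕ∞) f) (hε : 0 < ε) :
    ContDiff ℝ (⊤ : ℕ∞) (regHessianNorm ε f) := by
  refine ContDiff.sqrt (contDiff_const.add (ContDiff.sum fun i _ => ContDiff.sum fun j _ =>
    ((hf.partialDeriv j).partialDeriv i).pow 2)) fun x => ?_
  positivity

theorem partialDeriv_regHessianNorm (hf : ContDiff ℝ (⊤ : ℕ∞) f) (hε : 0 < ε) (i : Fin n)
    (x : EuclideanSpace ℝ (Fin n)) :
    partialDeriv i (regHessianNorm ε f) x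
      = (∑ k, ∑ l, partialDeriv k (partialDeriv l f) x
          * partialDeriv i (partialDeriv k (partialDeriv l f)) x) / regHessianNorm ε f x := by
  have hH (k l : Fin n) : HasFDerivAt (partialDeriv k (partialDeriv l f))
      (fderiv ℝ (partialDeriv k (partialDeriv l f)) x) x :=
    ((((hf.partialDeriv l).partialDeriv k).differentiable (by simp)) x).hasFDerivAt
  have h := (((HasFDerivAt.fun_sum fun k (_ : k ∈ Finset.univ) => HasFDerivAt.fun_sum
    fun l (_ : l ∈ Finset.univ) => (hH k l).pow 2).const_add (ε ^ 2)).sqrt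
    (by positivity)).fderiv
  have h' : fderiv ℝ (regHessianNorm ε f) x = _ := h
  rw [partialDeriv, h']
  simp only [smul_apply, sum_apply, smul_eq_mul,
    regHessianNorm, partialDeriv, Finset.mul_sum, Finset.sum_div]
  refine Finset.sum_congr rfl fun k _ => Finset.sum_congr rfl fun l _ => ?_
  simp
  ring

theorem integral_regHessianNorm_mul (hf : ContDiff ℝ (⊤ : ℕ∞) f) (hsupp : HasCompactSupport f)
    (hε : 0 < ε) :
    ∫ x, regHessianNorm ε f x * ∑ i, ∑ j, partialDeriv i (partialDeriv j f) x ^ 2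
      = ∫ x, -∑ i, ∑ j,
        ((∑ k, ∑ l, partialDeriv k (partialDeriv l f) x
            * partialDeriv i (partialDeriv k (partialDeriv l f)) x) / regHessianNorm ε f x
          * partialDeriv i (partialDeriv j f) x
          + regHessianNorm ε f x * partialDeriv i (partialDeriv i (partialDeriv j f)) x)
        * partialDeriv j f x := by
  have hg := contDiff_regHessianNorm hf hε
  have hH (i j : Fin n) := (hf.partialDeriv j).partialDeriv i
  have hgH (i j : Fin n) := hg.mul (hH i j)
  have hD (i j : Fin n) (x : EuclideanSpace ℝ (Fin n)) :
      partialDeriv i (fun y => regHessianNorm ε f y * partialDeriv i (partialDeriv j f) y) x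
        = (∑ k, ∑ l, partialDeriv k (partialDeriv l f) x
            * partialDeriv i (partialDeriv k (partialDeriv l f)) x) / regHessianNorm ε f x
          * partialDeriv i (partialDeriv j f) x
          + regHessianNorm ε f x * partialDeriv i (partialDeriv i (partialDeriv j f)) x := by
    rw [← partialDeriv_regHessianNorm hf hε, partialDeriv,
      fderiv_fun_mul (hg.differentiable (by simp) x) ((hH i j).differentiable (by simp) x)]
    simp [partialDeriv]
    ring
  simp_rw [← hD, Finset.mul_sum]
  have h_int1 (i j : Fin n) : Integrable fun x =>
      regHessianNorm ε f x * partialDeriv i (partialDeriv j f) x ^ 2 := by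
    refine (hg.continuous.mul ((hH i j).continuous.pow 2)).integrable_of_hasCompactSupport
      (HasCompactSupport.mul_left ?_)
    exact ((hsupp.partialDeriv j).partialDeriv i).mono fun x hx h0 => hx (by simp [h0])
  have h_int2 (i j : Fin n) : Integrable fun x =>
      partialDeriv i (fun y => regHessianNorm ε f y * partialDeriv i (partialDeriv j f) y) x
        * partialDeriv j f x :=
    (((hgH i j).partialDeriv i).continuous.mul
      (hf.partialDeriv j).continuous).integrable_of_hasCompactSupport
      (hsupp.partialDeriv j).mul_left
  rw [integral_neg, integral_finsetSum _ fun i _ => integrable_finsetSum _ fun j _ => h_int1 i j,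
    integral_finsetSum _ fun i _ => integrable_finsetSum _ fun j _ => h_int2 i j,
    ← Finset.sum_neg_distrib]
  refine Finset.sum_congr rfl fun i _ => ?_
  rw [integral_finsetSum _ fun j _ => h_int1 i j, integral_finsetSum _ fun j _ => h_int2 i j,
    ← Finset.sum_neg_distrib]
  refine Finset.sum_congr rfl fun j _ => ?_
  rw [← integral_mul_partialDeriv (hgH i j) (hf.partialDeriv j) (hsupp.partialDeriv j)]
  simp only [pow_two, mul_assoc]

end Regularization

theorem integral_hsNormDeriv_two_cubed_le_add {f : EuclideanSpace ℝ (Fin 3) → ℝ}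
    (hf : ContDiff ℝ (⊤ : ℕ∞) f) (hsupp : HasCompactSupport f) {ε : ℝ} (hε : 0 < ε) :
    ∫ x, hsNormDeriv 2 f x ^ 3
      ≤ 5 * (∫ x, hsNormDeriv 1 f x * hsNormDeriv 2 f x * hsNormDeriv 3 f x)
        + ε * (5 * ∫ x, hsNormDeriv 1 f x * hsNormDeriv 3 f x) := by
  have hg := (contDiff_regHessianNorm hf hε).continuous
  have hc := continuous_hsNormDeriv hf
  have hcs (k : ℕ) := hsupp.hsNormDeriv k
  have hgle (x) : regHessianNorm ε f x ≤ hsNormDeriv 2 f x + ε := by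
    rw [hsNormDeriv_two hf, regHessianNorm, Real.sqrt_le_left (by positivity), add_sq,
      Real.sq_sqrt (by positivity)]
    have : 0 ≤ √(∑ i, ∑ j, partialDeriv i (partialDeriv j f) x ^ 2) * ε := by positivity
    linarith
  have hleg (x) : hsNormDeriv 2 f x ≤ regHessianNorm ε f x := by
    rw [hsNormDeriv_two hf, regHessianNorm]
    exact Real.sqrt_le_sqrt (by nlinarith)
  have hsq (x) : ∑ i, ∑ j, partialDeriv i (partialDeriv j f) x ^ 2 = hsNormDeriv 2 f x ^ 2 := by
    rw [hsNormDeriv_two hf, Real.sq_sqrt (by positivity)]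
  have hcard : 1 + √(Fintype.card (Fin 3) : ℝ) ≤ 5 := by
    have : √(3 : ℝ) ≤ 4 := Real.sqrt_le_iff.2 (by norm_num)
    simp only [Fintype.card_fin, Nat.cast_ofNat]
    linarith
  have h_int : Integrable fun x => hsNormDeriv 1 f x * hsNormDeriv 2 f x * hsNormDeriv 3 f x :=
    (((hc 1).mul (hc 2)).mul (hc 3)).integrable_of_hasCompactSupport (hcs 3).mul_left
  have h_int' : Integrable fun x => hsNormDeriv 1 f x * hsNormDeriv 3 f x :=
    ((hc 1).mul (hc 3)).integrable_of_hasCompactSupport (hcs 3).mul_left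
  have hsupp_pow (k : ℕ) (hk : k ≠ 0) : HasCompactSupport fun x => hsNormDeriv 2 f x ^ k :=
    (hcs 2).mono fun x hx h0 => hx (by simp [h0, hk])
  have hpoint (x) : -∑ i, ∑ j,
      ((∑ k, ∑ l, partialDeriv k (partialDeriv l f) x
          * partialDeriv i (partialDeriv k (partialDeriv l f)) x) / regHessianNorm ε f x
        * partialDeriv i (partialDeriv j f) x
        + regHessianNorm ε f x * partialDeriv i (partialDeriv i (partialDeriv j f)) x)
      * partialDeriv j f x
      ≤ 5 * (hsNormDeriv 1 f x * hsNormDeriv 2 f x * hsNormDeriv 3 f x)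
        + ε * (5 * (hsNormDeriv 1 f x * hsNormDeriv 3 f x)) := by
    refine (neg_sum_divergence_mul_le (fun j => partialDeriv j f x)
      (fun i j => partialDeriv i (partialDeriv j f) x)
      (fun i k l => partialDeriv i (partialDeriv k (partialDeriv l f)) x)
      (regHessianNorm_pos hε x) (by rw [← hsNormDeriv_two hf]; exact hleg x)).trans ?_
    rw [← hsNormDeriv_one hf, ← hsNormDeriv_three hf]
    have h1 := hsNormDeriv_nonneg 1 f x
    have h2 := hsNormDeriv_nonneg 2 f x
    have h3 := hsNormDeriv_nonneg 3 f x
    calc _ ≤ 5 * (hsNormDeriv 1 f x * (hsNormDeriv 2 f x + ε) * hsNormDeriv 3 f x) := by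
          have := hgle x
          have := regHessianNorm_pos (f := f) hε x
          gcongr
      _ = _ := by ring
  calc ∫ x, hsNormDeriv 2 f x ^ 3
      ≤ ∫ x, regHessianNorm ε f x * ∑ i, ∑ j, partialDeriv i (partialDeriv j f) x ^ 2 := by
        simp_rw [hsq]
        refine integral_mono
          (((hc 2).pow 3).integrable_of_hasCompactSupport (hsupp_pow 3 three_ne_zero))
          ((hg.mul ((hc 2).pow 2)).integrable_of_hasCompactSupport
            (hsupp_pow 2 two_ne_zero).mul_left) fun x => ?_
        have := mul_le_mul_of_nonneg_right (hleg x) (sq_nonneg (hsNormDeriv 2 f x))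
        calc hsNormDeriv 2 f x ^ 3 = hsNormDeriv 2 f x * hsNormDeriv 2 f x ^ 2 := by ring
          _ ≤ _ := this
    _ = _ := integral_regHessianNorm_mul hf hsupp hε
    _ ≤ ∫ x, (5 * (hsNormDeriv 1 f x * hsNormDeriv 2 f x * hsNormDeriv 3 f x)
        + ε * (5 * (hsNormDeriv 1 f x * hsNormDeriv 3 f x))) := by
        refine integral_mono ?_ ((h_int.const_mul 5).add ((h_int'.const_mul 5).const_mul ε)) hpoint
        refine Continuous.integrable_of_hasCompactSupport ?_ ?_
        · have hH (i j : Fin 3) := ((hf.partialDeriv j).partialDeriv i).continuous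
          have hT (i j k : Fin 3) :=
            (((hf.partialDeriv k).partialDeriv j).partialDeriv i).continuous
          have hp (j : Fin 3) := (hf.partialDeriv j).continuous
          refine (continuous_finsetSum _ fun i _ => continuous_finsetSum _ fun j _ => ?_).neg
          refine Continuous.mul (((Continuous.div ?_ hg
            fun x => (regHessianNorm_pos hε x).ne').mul (hH i j)).add (hg.mul (hT i i j))) (hp j)
          exact continuous_finsetSum _ fun k _ => continuous_finsetSum _ fun l _ =>
            (hH k l).mul (hT i k l)
        · refine hsupp.fderiv (𝕜 := ℝ) |>.mono' fun x hx => ?_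
          by_contra hx'
          have h0 : fderiv ℝ f x = 0 := image_eq_zero_of_notMem_tsupport hx'
          exact hx (by simp [partialDeriv, h0])
    _ = _ := by
        rw [integral_add (h_int.const_mul 5) ((h_int'.const_mul 5).const_mul ε)]
        simp only [integral_const_mul]

/-- For a smooth compactly supported `f : ℝ³ → ℝ`,
`∫ |∇²f|³ ≤ 5 ∫ |∇f|·|∇²f|·|∇³f|` (integration-by-parts inequality, with
Hilbert–Schmidt norms of the derivatives). -/
theorem hessian_cubed_integration_by_parts
    (f : EuclideanSpace ℝ (Fin 3) → ℝ)
    (hf : ContDiff ℝ (⊤ : ℕ∞) f) (hsupp : HasCompactSupport f) :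
    ∫ x, hsNormDeriv 2 f x ^ 3
      ≤ 5 * ∫ x, hsNormDeriv 1 f x * hsNormDeriv 2 f x * hsNormDeriv 3 f x := by
  set B := 5 * ∫ x, hsNormDeriv 1 f x * hsNormDeriv 3 f x
  have hlim : Filter.Tendsto
      (fun ε : ℝ => 5 * (∫ x, hsNormDeriv 1 f x * hsNormDeriv 2 f x * hsNormDeriv 3 f x) + ε * B)
      (nhdsWithin 0 (Set.Ioi 0))
      (nhds (5 * ∫ x, hsNormDeriv 1 f x * hsNormDeriv 2 f x * hsNormDeriv 3 f x)) := by
    refine tendsto_nhdsWithin_of_tendsto_nhds (Continuous.tendsto' (by fun_prop) _ _ (by simp))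
  exact ge_of_tendsto hlim (eventually_nhdsWithin_of_forall fun ε hε =>
    integral_hsNormDeriv_two_cubed_le_add hf hsupp hε)
end

section
/- Let f : ℝ³ → ℝ be a smooth function with compact support. Then ‖∇²f‖_{L³(ℝ³)}² ≤ 5·‖∇f‖_{L⁶(ℝ³)}·‖∇³f‖_{L²(ℝ³)}, i.e. ( ∫_{ℝ³} |∇²f|³ dx )^{2/3} ≤ 5·( ∫_{ℝ³} |∇f|⁶ dx )^{1/6}·( ∫_{ℝ³} |∇³f|² dx )^{1/2}. -/
open MeasureTheory

namespace HessianInterpolation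

/-- The partial derivative of `g` in the `j`-th coordinate direction. -/
noncomputable def partialDeriv (j : Fin 3) (g : EuclideanSpace ℝ (Fin 3) → ℝ)
    (x : EuclideanSpace ℝ (Fin 3)) : ℝ :=
  fderiv ℝ g x (EuclideanSpace.single j 1)

lemma contDiff_partialDeriv {g : EuclideanSpace ℝ (Fin 3) → ℝ}
    (hg : ContDiff ℝ (⊤ : ℕ∞) g) (j : Fin 3) : ContDiff ℝ (⊤ : ℕ∞) (partialDeriv j g) :=
  (hg.fderiv_right (m := (⊤ : ℕ∞)) (by simp)).clm_apply contDiff_const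

lemma hasCompactSupport_partialDeriv {g : EuclideanSpace ℝ (Fin 3) → ℝ}
    (hg : HasCompactSupport g) (j : Fin 3) : HasCompactSupport (partialDeriv j g) :=
  hg.fderiv_apply ℝ _

lemma abs_sum_mul_le_sqrt_mul_sqrt {ι : Type*} (s : Finset ι) (f g : ι → ℝ) :
    |∑ i ∈ s, f i * g i| ≤ √(∑ i ∈ s, f i ^ 2) * √(∑ i ∈ s, g i ^ 2) := by
  rw [← Real.sqrt_mul (Finset.sum_nonneg fun _ _ => sq_nonneg _)]
  exact Real.abs_le_sqrt (Finset.sum_mul_sq_le_sq_mul_sq s f g)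

/-- Bound for `-∑ u · ∂(φ ∇u)`, where `φ = s` regularizes `|∇u|`, in terms of the components
`a` of `u`, `b` of `∇u` and `c` of `∇²u`. -/
lemma abs_sum_regularized_le {ι : Type*} [Fintype ι] (a : ι → ℝ) (b : Fin 3 → ι → ℝ)
    (c : Fin 3 → Fin 3 → ι → ℝ) {s : ℝ} (hs : 0 < s) (hbs : √(∑ j, ∑ i, b j i ^ 2) ≤ s) :
    |∑ j, ∑ i, a i * ((∑ l, ∑ k, b l k * c j l k) / s * b j i + s * c j j i)| ≤
      √(∑ i, a i ^ 2) * √(∑ j, ∑ l, ∑ k, c j l k ^ 2) * (√(∑ j, ∑ i, b j i ^ 2) + 2 * s) := by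
  set A := √(∑ i, a i ^ 2)
  set B := √(∑ j, ∑ i, b j i ^ 2) with hB
  set C := √(∑ j, ∑ l, ∑ k, c j l k ^ 2)
  have hA0 : 0 ≤ A := Real.sqrt_nonneg _
  have hB0 : 0 ≤ B := Real.sqrt_nonneg _
  have hC0 : 0 ≤ C := Real.sqrt_nonneg _
  have hA2 : A ^ 2 = ∑ i, a i ^ 2 := Real.sq_sqrt (by positivity)
  have hC2 : C ^ 2 = ∑ j, ∑ l, ∑ k, c j l k ^ 2 := Real.sq_sqrt (by positivity)
  set q : Fin 3 → ℝ := fun j => (∑ l, ∑ k, b l k * c j l k) / s with hq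
  have hqj (j : Fin 3) : q j ^ 2 ≤ ∑ l, ∑ k, c j l k ^ 2 := by
    have h := abs_sum_mul_le_sqrt_mul_sqrt (Finset.univ : Finset (Fin 3 × ι))
      (fun p => b p.1 p.2) (fun p => c j p.1 p.2)
    simp only [Fintype.sum_prod_type] at h
    rw [← hB] at h
    have h2 : |q j| ≤ √(∑ l, ∑ k, c j l k ^ 2) := by
      rw [hq, abs_div, abs_of_pos hs, div_le_iff₀ hs, mul_comm]
      exact h.trans (by gcongr)
    rw [← sq_abs, ← Real.sq_sqrt (show 0 ≤ ∑ l, ∑ k, c j l k ^ 2 by positivity)]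
    gcongr
  have h1 : |∑ j, ∑ i, (a i * q j) * b j i| ≤ A * C * B := by
    have h := abs_sum_mul_le_sqrt_mul_sqrt (Finset.univ : Finset (Fin 3 × ι))
      (fun p => a p.2 * q p.1) (fun p => b p.1 p.2)
    simp only [Fintype.sum_prod_type] at h
    refine h.trans (mul_le_mul_of_nonneg_right ?_ hB0)
    rw [Real.sqrt_le_left (by positivity), mul_pow, hA2, hC2, Finset.mul_sum]
    refine Finset.sum_le_sum fun j _ => ?_
    simp only [mul_pow, ← Finset.sum_mul]
    exact mul_le_mul_of_nonneg_left (hqj j) (by positivity)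
  have h2 : |∑ j, ∑ i, a i * c j j i| ≤ 2 * A * C := by
    have h := abs_sum_mul_le_sqrt_mul_sqrt (Finset.univ : Finset (Fin 3 × ι))
      (fun p => a p.2) (fun p => c p.1 p.1 p.2)
    simp only [Fintype.sum_prod_type] at h
    refine h.trans (mul_le_mul ?_ ?_ (Real.sqrt_nonneg _) (by positivity))
    · rw [Real.sqrt_le_left (by positivity), mul_pow, hA2]
      simp only [Finset.sum_const, Finset.card_univ, Fintype.card_fin, nsmul_eq_mul]
      push_cast
      nlinarith [sq_nonneg A]
    · refine Real.sqrt_le_sqrt (Finset.sum_le_sum fun j _ => ?_)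
      exact Finset.single_le_sum (f := fun l => ∑ k, c j l k ^ 2)
        (fun l _ => by positivity) (Finset.mem_univ j)
  have hsplit : ∑ j, ∑ i, a i * (q j * b j i + s * c j j i) =
      ∑ j, ∑ i, (a i * q j) * b j i + s * ∑ j, ∑ i, a i * c j j i := by
    simp only [Finset.mul_sum, ← Finset.sum_add_distrib]
    refine Finset.sum_congr rfl fun j _ => Finset.sum_congr rfl fun i _ => ?_
    ring
  calc |∑ j, ∑ i, a i * (q j * b j i + s * c j j i)|
      ≤ |∑ j, ∑ i, (a i * q j) * b j i| + s * |∑ j, ∑ i, a i * c j j i| := by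
        rw [hsplit]
        refine (abs_add_le _ _).trans_eq ?_
        rw [abs_mul, abs_of_pos hs]
    _ ≤ A * C * B + s * (2 * A * C) := by gcongr
    _ = A * C * (B + 2 * s) := by ring

section VectorField

variable {ι : Type*} [Fintype ι] {u : ι → EuclideanSpace ℝ (Fin 3) → ℝ}

lemma integral_regularized_le (hu : ∀ i, ContDiff ℝ (⊤ : ℕ∞) (u i))
    (hc : ∀ i, HasCompactSupport (u i)) {ε : ℝ} (hε : 0 < ε)
    (hbound : Integrable fun x => √(∑ i, u i x ^ 2) *
      √(∑ l, ∑ j, ∑ i, partialDeriv l (partialDeriv j (u i)) x ^ 2) *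
      (√(∑ j, ∑ i, partialDeriv j (u i) x ^ 2) +
        2 * √(ε ^ 2 + ∑ j, ∑ i, partialDeriv j (u i) x ^ 2))) :
    ∫ x, √(ε ^ 2 + ∑ j, ∑ i, partialDeriv j (u i) x ^ 2) *
        ∑ j, ∑ i, partialDeriv j (u i) x ^ 2 ≤
      ∫ x, √(∑ i, u i x ^ 2) *
        √(∑ l, ∑ j, ∑ i, partialDeriv l (partialDeriv j (u i)) x ^ 2) *
        (√(∑ j, ∑ i, partialDeriv j (u i) x ^ 2) +
          2 * √(ε ^ 2 + ∑ j, ∑ i, partialDeriv j (u i) x ^ 2)) := by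
  have hb (j i) : ContDiff ℝ (⊤ : ℕ∞) (partialDeriv j (u i)) := contDiff_partialDeriv (hu i) j
  have hbc (j i) : HasCompactSupport (partialDeriv j (u i)) :=
    hasCompactSupport_partialDeriv (hc i) j
  set φ : EuclideanSpace ℝ (Fin 3) → ℝ :=
    fun x => √(ε ^ 2 + ∑ j, ∑ i, partialDeriv j (u i) x ^ 2)
  have hpos (x) : 0 < ε ^ 2 + ∑ j, ∑ i, partialDeriv j (u i) x ^ 2 := by positivity
  have hφsmooth : ContDiff ℝ (⊤ : ℕ∞) φ := by
    refine ContDiff.sqrt ?_ fun x => (hpos x).ne'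
    exact contDiff_const.add (ContDiff.sum fun j _ => ContDiff.sum fun i _ => (hb j i).pow 2)
  have hφpos (x) : 0 < φ x := Real.sqrt_pos.2 (hpos x)
  have hdφ (x) (l : Fin 3) : partialDeriv l φ x =
      (∑ j, ∑ i, partialDeriv j (u i) x * partialDeriv l (partialDeriv j (u i)) x) / φ x := by
    have hd (j i) : HasFDerivAt (partialDeriv j (u i)) (fderiv ℝ (partialDeriv j (u i)) x) x :=
      ((hb j i).differentiable (by simp) x).hasFDerivAt
    have h : HasFDerivAt (fun x => ε ^ 2 + ∑ j, ∑ i, partialDeriv j (u i) x ^ 2) _ x :=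
      (HasFDerivAt.fun_sum fun j (_ : j ∈ Finset.univ) =>
        HasFDerivAt.fun_sum fun i (_ : i ∈ Finset.univ) => (hd j i).pow 2).const_add (ε ^ 2)
    have h' := h.sqrt (hpos x).ne'
    rw [partialDeriv, h'.fderiv]
    have hne := (hφpos x).ne'
    simp only [smul_apply, sum_apply, smul_eq_mul,
      nsmul_eq_mul, Finset.mul_sum, Finset.sum_div]
    refine Finset.sum_congr rfl fun j _ => Finset.sum_congr rfl fun i _ => ?_
    change 1 / (2 * φ x) * _ = _ / φ x
    field_simp
    norm_num [partialDeriv]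
  have hg (j i) : ContDiff ℝ (⊤ : ℕ∞) (fun x => φ x * partialDeriv j (u i) x) :=
    hφsmooth.mul (hb j i)
  have hdg (j i x) : partialDeriv j (fun x => φ x * partialDeriv j (u i) x) x =
      partialDeriv j φ x * partialDeriv j (u i) x +
        φ x * partialDeriv j (partialDeriv j (u i)) x := by
    rw [partialDeriv, fderiv_fun_mul (hφsmooth.differentiable (by simp) x)
      ((hb j i).differentiable (by simp) x)]
    simp only [partialDeriv, add_apply, smul_apply, smul_eq_mul]
    ring
  have hi1 (j i) : Integrable fun x =>
      (φ x * partialDeriv j (u i) x) * partialDeriv j (u i) x :=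
    ((hg j i).continuous.mul (hb j i).continuous).integrable_of_hasCompactSupport
      ((hbc j i).mul_left)
  have hi2 (j i) : Integrable fun x =>
      partialDeriv j (fun x => φ x * partialDeriv j (u i) x) x * u i x :=
    ((contDiff_partialDeriv (hg j i) j).continuous.mul
      (hu i).continuous).integrable_of_hasCompactSupport ((hc i).mul_left)
  have hi3 (j i) : Integrable fun x => (φ x * partialDeriv j (u i) x) * u i x :=
    ((hg j i).continuous.mul (hu i).continuous).integrable_of_hasCompactSupport ((hc i).mul_left)
  have hibp (j i) : ∫ x, (φ x * partialDeriv j (u i) x) * partialDeriv j (u i) x =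
      -∫ x, partialDeriv j (fun x => φ x * partialDeriv j (u i) x) x * u i x :=
    integral_mul_fderiv_eq_neg_fderiv_mul_of_integrable (hi2 j i) (hi1 j i) (hi3 j i)
      (fun x _ => (hg j i).differentiable (by simp) x)
      (fun x _ => (hu i).differentiable (by simp) x)
  calc ∫ x, φ x * ∑ j, ∑ i, partialDeriv j (u i) x ^ 2
      = ∫ x, ∑ j, ∑ i, (φ x * partialDeriv j (u i) x) * partialDeriv j (u i) x := by
        refine integral_congr_ae (Filter.Eventually.of_forall fun x => ?_)
        simp only [Finset.mul_sum]
        refine Finset.sum_congr rfl fun j _ => Finset.sum_congr rfl fun i _ => ?_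
        ring
    _ = ∫ x, -∑ j, ∑ i, partialDeriv j (fun x => φ x * partialDeriv j (u i) x) x * u i x := by
        rw [integral_neg,
          integral_finsetSum _ fun j _ => integrable_finsetSum _ fun i _ => hi1 j i,
          integral_finsetSum _ fun j _ => integrable_finsetSum _ fun i _ => hi2 j i,
          ← Finset.sum_neg_distrib]
        refine Finset.sum_congr rfl fun j _ => ?_
        rw [integral_finsetSum _ fun i _ => hi1 j i, integral_finsetSum _ fun i _ => hi2 j i,
          ← Finset.sum_neg_distrib]
        exact Finset.sum_congr rfl fun i _ => hibp j i
    _ ≤ _ := by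
        refine integral_mono
          (integrable_finsetSum _ fun j _ => integrable_finsetSum _ fun i _ => hi2 j i).neg
          hbound fun x => (neg_le_abs _).trans ?_
        have h := abs_sum_regularized_le (fun i => u i x) (fun j i => partialDeriv j (u i) x)
          (fun l j i => partialDeriv l (partialDeriv j (u i)) x) (hφpos x)
          (Real.sqrt_le_sqrt (by nlinarith [sq_nonneg ε]))
        refine le_of_eq_of_le ?_ h
        congr 1
        refine Finset.sum_congr rfl fun j _ => Finset.sum_congr rfl fun i _ => ?_
        rw [hdg, hdφ, mul_comm]

lemma hasCompactSupport_sqrt_sum {κ : Type*} [Fintype κ] {X : Type*} [TopologicalSpace X]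
    {v : κ → X → ℝ} (hv : ∀ k, HasCompactSupport (v k)) :
    HasCompactSupport fun x => √(∑ k, v k x ^ 2) := by
  simp only [hasCompactSupport_iff_eventuallyEq] at hv ⊢
  filter_upwards [Filter.eventually_all.2 hv] with x hx
  simp [hx]

lemma hasCompactSupport_pow {X : Type*} [TopologicalSpace X] {g : X → ℝ}
    (hg : HasCompactSupport g) {n : ℕ} (hn : n ≠ 0) : HasCompactSupport fun x => g x ^ n :=
  hg.comp_left (g := fun t : ℝ => t ^ n) (zero_pow hn)

/-- The integration-by-parts bound `∫ |∇u|³ ≤ 3 ∫ |u| |∇²u| |∇u|` for a smooth compactly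
supported vector field `u` on `ℝ³`. -/
lemma integral_gradient_cube_le (hu : ∀ i, ContDiff ℝ (⊤ : ℕ∞) (u i))
    (hc : ∀ i, HasCompactSupport (u i)) :
    ∫ x, √(∑ j, ∑ i, partialDeriv j (u i) x ^ 2) ^ 3 ≤
      3 * ∫ x, √(∑ i, u i x ^ 2) *
        √(∑ l, ∑ j, ∑ i, partialDeriv l (partialDeriv j (u i)) x ^ 2) *
        √(∑ j, ∑ i, partialDeriv j (u i) x ^ 2) := by
  have hb (j i) : Continuous (partialDeriv j (u i)) := (contDiff_partialDeriv (hu i) j).continuous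
  have hbb (l j i) : Continuous (partialDeriv l (partialDeriv j (u i))) :=
    (contDiff_partialDeriv (contDiff_partialDeriv (hu i) j) l).continuous
  have hu0 (i) : Continuous (u i) := (hu i).continuous
  set N : EuclideanSpace ℝ (Fin 3) → ℝ := fun x => √(∑ i, u i x ^ 2)
  set H : EuclideanSpace ℝ (Fin 3) → ℝ := fun x => √(∑ j, ∑ i, partialDeriv j (u i) x ^ 2)
  set T : EuclideanSpace ℝ (Fin 3) → ℝ :=
    fun x => √(∑ l, ∑ j, ∑ i, partialDeriv l (partialDeriv j (u i)) x ^ 2)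
  have hNc : Continuous N := by fun_prop
  have hHc : Continuous H := by fun_prop
  have hTc : Continuous T := by fun_prop
  have hNs : HasCompactSupport N := hasCompactSupport_sqrt_sum hc
  have hHs : HasCompactSupport H := by
    have := hasCompactSupport_sqrt_sum
      (v := fun p : Fin 3 × ι => partialDeriv p.1 (u p.2))
      fun p => hasCompactSupport_partialDeriv (hc p.2) p.1
    simpa only [Fintype.sum_prod_type] using this
  have hNTs : HasCompactSupport fun x => N x * T x := hNs.mul_right
  have hint1 : Integrable fun x => N x * T x :=
    (hNc.mul hTc).integrable_of_hasCompactSupport hNTs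
  have hint2 : Integrable fun x => N x * T x * H x :=
    ((hNc.mul hTc).mul hHc).integrable_of_hasCompactSupport hNTs.mul_right
  have hH2 (x) : H x ^ 2 = ∑ j, ∑ i, partialDeriv j (u i) x ^ 2 :=
    Real.sq_sqrt (by positivity)
  have hreg (ε : ℝ) (hε : 0 < ε)
      (h : Integrable fun x => N x * T x * (H x + 2 * √(ε ^ 2 + H x ^ 2))) :
      ∫ x, √(ε ^ 2 + H x ^ 2) * H x ^ 2 ≤
        ∫ x, N x * T x * (H x + 2 * √(ε ^ 2 + H x ^ 2)) := by
    simp only [hH2] at h ⊢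
    exact integral_regularized_le hu hc hε h
  have hN0 (x) : 0 ≤ N x := Real.sqrt_nonneg _
  have hH0 (x) : 0 ≤ H x := Real.sqrt_nonneg _
  have hT0 (x) : 0 ≤ T x := Real.sqrt_nonneg _
  change ∫ x, H x ^ 3 ≤ 3 * ∫ x, N x * T x * H x
  clear_value N H T
  have key (ε : ℝ) (hε : 0 < ε) :
      ∫ x, H x ^ 3 ≤ 3 * (∫ x, N x * T x * H x) + (2 * ∫ x, N x * T x) * ε := by
    have hφc : Continuous fun x => √(ε ^ 2 + H x ^ 2) := by fun_prop
    have hbound : Integrable fun x => N x * T x * (H x + 2 * √(ε ^ 2 + H x ^ 2)) :=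
      Continuous.integrable_of_hasCompactSupport (by fun_prop) hNTs.mul_right
    have hφH : Integrable fun x => √(ε ^ 2 + H x ^ 2) * H x ^ 2 :=
      (hφc.mul (hHc.pow 2)).integrable_of_hasCompactSupport
        (hasCompactSupport_pow hHs two_ne_zero).mul_left
    calc ∫ x, H x ^ 3
        ≤ ∫ x, √(ε ^ 2 + H x ^ 2) * H x ^ 2 := by
          refine integral_mono ((hHc.pow 3).integrable_of_hasCompactSupport
            (hasCompactSupport_pow hHs three_ne_zero)) hφH fun x => ?_
          change H x ^ 3 ≤ √(ε ^ 2 + H x ^ 2) * H x ^ 2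
          rw [pow_succ' (H x) 2]
          refine mul_le_mul_of_nonneg_right ?_ (sq_nonneg _)
          exact Real.le_sqrt_of_sq_le (by nlinarith [sq_nonneg ε])
      _ ≤ ∫ x, N x * T x * (H x + 2 * √(ε ^ 2 + H x ^ 2)) := hreg ε hε hbound
      _ ≤ ∫ x, (3 * (N x * T x * H x) + (2 * ε) * (N x * T x)) := by
          refine integral_mono hbound ((hint2.const_mul 3).add (hint1.const_mul (2 * ε))) fun x => ?_
          have h : √(ε ^ 2 + H x ^ 2) ≤ H x + ε := by
            rw [Real.sqrt_le_left (add_nonneg (hH0 x) hε.le)]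
            nlinarith [mul_nonneg (hH0 x) hε.le]
          change N x * T x * (H x + 2 * √(ε ^ 2 + H x ^ 2)) ≤
            3 * (N x * T x * H x) + (2 * ε) * (N x * T x)
          nlinarith [mul_le_mul_of_nonneg_left h (mul_nonneg (hN0 x) (hT0 x))]
      _ = _ := by
          rw [integral_add (hint2.const_mul 3) (hint1.const_mul (2 * ε)), integral_const_mul,
            integral_const_mul]
          ring
  have hlim : Filter.Tendsto
      (fun ε : ℝ => 3 * (∫ x, N x * T x * H x) + (2 * ∫ x, N x * T x) * ε)
      (nhdsWithin 0 (Set.Ioi 0)) (nhds (3 * (∫ x, N x * T x * H x))) := by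
    refine (Continuous.tendsto' (by fun_prop) 0 _ (by simp)).mono_left nhdsWithin_le_nhds
  exact ge_of_tendsto hlim (eventually_mem_nhdsWithin.mono key)

end VectorField

/-- Hölder's inequality with exponents `6`, `3`, `2`. -/
lemma integral_mul_mul_le {X : Type*} [TopologicalSpace X] [MeasurableSpace X]
    [OpensMeasurableSpace X] {μ : Measure X} [IsFiniteMeasureOnCompacts μ]
    {N H T : X → ℝ} (hN : Continuous N) (hH : Continuous H) (hT : Continuous T)
    (hNs : HasCompactSupport N) (hHs : HasCompactSupport H) (hTs : HasCompactSupport T)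
    (hN0 : 0 ≤ N) (hH0 : 0 ≤ H) (hT0 : 0 ≤ T) :
    ∫ x, N x * T x * H x ∂μ ≤ (∫ x, N x ^ 6 ∂μ) ^ ((1 : ℝ) / 6) *
      (∫ x, H x ^ 3 ∂μ) ^ ((1 : ℝ) / 3) * (∫ x, T x ^ 2 ∂μ) ^ ((1 : ℝ) / 2) := by
  have h1 := integral_mul_le_Lp_mul_Lq_of_nonneg (μ := μ) (p := 2) (q := 2)
    (f := fun x => N x * H x) (g := T) (by constructor <;> norm_num)
    (Filter.Eventually.of_forall fun x => mul_nonneg (hN0 x) (hH0 x))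
    (Filter.Eventually.of_forall hT0)
    ((hN.mul hH).memLp_of_hasCompactSupport hNs.mul_right) (hT.memLp_of_hasCompactSupport hTs)
  have h2 := integral_mul_le_Lp_mul_Lq_of_nonneg (μ := μ) (p := 3) (q := 3 / 2)
    (f := fun x => N x ^ 2) (g := fun x => H x ^ 2) (by constructor <;> norm_num)
    (Filter.Eventually.of_forall fun x => sq_nonneg _)
    (Filter.Eventually.of_forall fun x => sq_nonneg _)
    ((hN.pow 2).memLp_of_hasCompactSupport (hasCompactSupport_pow hNs two_ne_zero))
    ((hH.pow 2).memLp_of_hasCompactSupport (hasCompactSupport_pow hHs two_ne_zero))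
  have eN (x) : (N x ^ 2) ^ (3 : ℝ) = N x ^ 6 := by
    rw [show (3 : ℝ) = (3 : ℕ) by norm_num, Real.rpow_natCast, ← pow_mul]
  have eH (x) : (H x ^ 2) ^ (3 / 2 : ℝ) = H x ^ 3 := by
    rw [← Real.rpow_natCast_mul (hH0 x), ← Real.rpow_natCast]
    norm_num
  simp only [eN, eH] at h2
  simp only [Real.rpow_two, mul_pow] at h1
  have hI (g : X → ℝ) (hg : 0 ≤ g) (n : ℕ) : 0 ≤ ∫ x, g x ^ n ∂μ :=
    integral_nonneg fun x => pow_nonneg (hg x) n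
  calc ∫ x, N x * T x * H x ∂μ = ∫ x, N x * H x * T x ∂μ :=
        integral_congr_ae (Filter.Eventually.of_forall fun x => mul_right_comm _ _ _)
    _ ≤ _ := h1
    _ ≤ ((∫ x, N x ^ 6 ∂μ) ^ ((1 : ℝ) / 3) * (∫ x, H x ^ 3 ∂μ) ^ (1 / (3 / 2 : ℝ))) ^
          ((1 : ℝ) / 2) * (∫ x, T x ^ 2 ∂μ) ^ ((1 : ℝ) / 2) := by
        have := hI T hT0 2
        gcongr
    _ = _ := by
        rw [Real.mul_rpow (Real.rpow_nonneg (hI N hN0 6) _) (Real.rpow_nonneg (hI H hH0 3) _),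
          ← Real.rpow_mul (hI N hN0 6), ← Real.rpow_mul (hI H hH0 3)]
        norm_num

lemma sum_fin_succ_arrow {k : ℕ} {α : Type*} [Fintype α] (g : (Fin (k + 1) → α) → ℝ) :
    ∑ m, g m = ∑ j, ∑ m : Fin k → α, g (Fin.cons j m) := by
  rw [← Fintype.sum_prod_type']
  exact (Fintype.sum_equiv (Fin.consEquiv fun _ => α) _ _ fun _ => rfl).symm

/-- The components of the `k`-th iterated derivative of `f` in the standard basis. -/
noncomputable def iteratedPartial (k : ℕ) (f : EuclideanSpace ℝ (Fin 3) → ℝ)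
    (m : Fin k → Fin 3) (x : EuclideanSpace ℝ (Fin 3)) : ℝ :=
  iteratedFDeriv ℝ k f x fun i => EuclideanSpace.single (m i) (1 : ℝ)

section IteratedPartial

variable {f : EuclideanSpace ℝ (Fin 3) → ℝ}

lemma contDiff_iteratedPartial (hf : ContDiff ℝ (⊤ : ℕ∞) f) {k : ℕ} (m : Fin k → Fin 3) :
    ContDiff ℝ (⊤ : ℕ∞) (iteratedPartial k f m) :=
  (ContinuousMultilinearMap.apply ℝ (fun _ : Fin k => EuclideanSpace ℝ (Fin 3)) ℝ
    fun i => EuclideanSpace.single (m i) (1 : ℝ)).contDiff.comp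
    (hf.iteratedFDeriv_right (m := (⊤ : ℕ∞)) (mod_cast le_top))

lemma hasCompactSupport_iteratedPartial (hf : HasCompactSupport f) {k : ℕ} (m : Fin k → Fin 3) :
    HasCompactSupport (iteratedPartial k f m) :=
  (hf.iteratedFDeriv (𝕜 := ℝ) k).comp_left
    (g := fun L : ContinuousMultilinearMap ℝ (fun _ : Fin k => EuclideanSpace ℝ (Fin 3)) ℝ =>
      L fun i => EuclideanSpace.single (m i) (1 : ℝ)) rfl

lemma partialDeriv_iteratedPartial (hf : ContDiff ℝ (⊤ : ℕ∞) f) {k : ℕ} (j : Fin 3)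
    (m : Fin k → Fin 3) :
    partialDeriv j (iteratedPartial k f m) = iteratedPartial (k + 1) f (Fin.cons j m) := by
  ext x
  have hd : HasFDerivAt (iteratedFDeriv ℝ k f) (fderiv ℝ (iteratedFDeriv ℝ k f) x) x :=
    (hf.differentiable_iteratedFDeriv (mod_cast ENat.natCast_lt_top k) x).hasFDerivAt
  have h := (ContinuousMultilinearMap.apply ℝ (fun _ : Fin k => EuclideanSpace ℝ (Fin 3)) ℝ
    fun i => EuclideanSpace.single (m i) (1 : ℝ)).hasFDerivAt.comp x hd
  have h' : fderiv ℝ (iteratedPartial k f m) x = _ := h.fderiv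
  rw [partialDeriv, h', iteratedPartial, iteratedFDeriv_succ_apply_left]
  rfl

lemma hsNormDeriv_one (x : EuclideanSpace ℝ (Fin 3)) :
    hsNormDeriv 1 f x = √(∑ m, iteratedPartial 1 f m x ^ 2) := rfl

lemma hsNormDeriv_two (hf : ContDiff ℝ (⊤ : ℕ∞) f) (x : EuclideanSpace ℝ (Fin 3)) :
    hsNormDeriv 2 f x = √(∑ j, ∑ m, partialDeriv j (iteratedPartial 1 f m) x ^ 2) := by
  simp only [partialDeriv_iteratedPartial hf]
  exact congrArg Real.sqrt (sum_fin_succ_arrow fun m => iteratedPartial 2 f m x ^ 2)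

lemma hsNormDeriv_three (hf : ContDiff ℝ (⊤ : ℕ∞) f) (x : EuclideanSpace ℝ (Fin 3)) :
    hsNormDeriv 3 f x =
      √(∑ l, ∑ j, ∑ m, partialDeriv l (partialDeriv j (iteratedPartial 1 f m)) x ^ 2) := by
  simp only [partialDeriv_iteratedPartial hf]
  refine congrArg Real.sqrt
    ((sum_fin_succ_arrow fun m => iteratedPartial 3 f m x ^ 2).trans ?_)
  exact Finset.sum_congr rfl fun l _ =>
    sum_fin_succ_arrow fun m => iteratedPartial 3 f (Fin.cons l m) x ^ 2

lemma continuous_hsNormDeriv (hf : ContDiff ℝ (⊤ : ℕ∞) f) (k : ℕ) :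
    Continuous (hsNormDeriv k f) :=
  Real.continuous_sqrt.comp (continuous_finsetSum _ fun m _ =>
    (contDiff_iteratedPartial hf m).continuous.pow 2)

lemma hasCompactSupport_hsNormDeriv (hf : HasCompactSupport f) (k : ℕ) :
    HasCompactSupport (hsNormDeriv k f) :=
  hasCompactSupport_sqrt_sum fun m => hasCompactSupport_iteratedPartial hf m

end IteratedPartial

end HessianInterpolation

/-- For a smooth compactly supported `f : ℝ³ → ℝ`,
`‖∇²f‖_{L³}² ≤ 5·‖∇f‖_{L⁶}·‖∇³f‖_{L²}`, i.e.
`(∫ |∇²f|³)^{2/3} ≤ 5 (∫ |∇f|⁶)^{1/6} (∫ |∇³f|²)^{1/2}`,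
with Hilbert–Schmidt norms of the derivatives. -/
theorem hessian_L3_interpolation
    (f : EuclideanSpace ℝ (Fin 3) → ℝ)
    (hf : ContDiff ℝ (⊤ : ℕ∞) f) (hsupp : HasCompactSupport f) :
    (∫ x, hsNormDeriv 2 f x ^ 3) ^ ((2 : ℝ)/3)
      ≤ 5 * (∫ x, hsNormDeriv 1 f x ^ 6) ^ ((1 : ℝ)/6) *
        (∫ x, hsNormDeriv 3 f x ^ 2) ^ ((1 : ℝ)/2) := by
  have hcube : ∫ x, hsNormDeriv 2 f x ^ 3 ≤
      3 * ∫ x, hsNormDeriv 1 f x * hsNormDeriv 3 f x * hsNormDeriv 2 f x := by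
    simp only [HessianInterpolation.hsNormDeriv_one, HessianInterpolation.hsNormDeriv_two hf,
      HessianInterpolation.hsNormDeriv_three hf]
    exact HessianInterpolation.integral_gradient_cube_le
      (HessianInterpolation.contDiff_iteratedPartial hf)
      (HessianInterpolation.hasCompactSupport_iteratedPartial hsupp)
  have hcont := HessianInterpolation.continuous_hsNormDeriv hf
  have hcs := HessianInterpolation.hasCompactSupport_hsNormDeriv hsupp
  have hnonneg (k : ℕ) : 0 ≤ hsNormDeriv k f := fun x => Real.sqrt_nonneg _
  have hholder := HessianInterpolation.integral_mul_mul_le (μ := volume) (hcont 1) (hcont 2)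
    (hcont 3) (hcs 1) (hcs 2) (hcs 3) (hnonneg 1) (hnonneg 2) (hnonneg 3)
  have hI (k n : ℕ) : 0 ≤ ∫ x, hsNormDeriv k f x ^ n :=
    integral_nonneg fun x => pow_nonneg (hnonneg k x) n
  set A := ∫ x, hsNormDeriv 2 f x ^ 3
  set P := (∫ x, hsNormDeriv 1 f x ^ 6) ^ ((1 : ℝ) / 6)
  set Q := (∫ x, hsNormDeriv 3 f x ^ 2) ^ ((1 : ℝ) / 2)
  have hP : 0 ≤ P := Real.rpow_nonneg (hI 1 6) _
  have hQ : 0 ≤ Q := Real.rpow_nonneg (hI 3 2) _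
  rcases (hI 2 3).eq_or_lt with hA | hA
  · rw [show A = 0 from hA.symm, Real.zero_rpow (by norm_num)]
    positivity
  · have hR : 0 < A ^ ((1 : ℝ) / 3) := Real.rpow_pos_of_pos hA _
    refine le_of_mul_le_mul_right ?_ hR
    rw [← Real.rpow_add hA, show (2 : ℝ) / 3 + 1 / 3 = 1 by norm_num, Real.rpow_one]
    have hPQ : 0 ≤ P * A ^ ((1 : ℝ) / 3) * Q := by positivity
    linarith [mul_right_comm (5 * P) Q (A ^ ((1 : ℝ) / 3))]
end
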